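/- arXiv:1612.05683 — 5 statements merged into one kernel-verified Lean document; each statement's English description precedes it below -/
import Mathlib

section
/- Let H be a complex Hilbert space, let T and S be bounded linear operators on H with S invertible, and let C ≥ 1. If ‖T‖ ≤ 1 and ‖S‖·‖S⁻¹‖ ≤ C, then the numerical radius satisfies w(S⁻¹ T S) ≤ (1/2)(C + C⁻¹). -/
open scoped InnerProductSpace
open ContinuousLinearMap Polynomial

noncomputable section

/-- The numerical radius `w(X) = sup { |⟨X x, x⟩| : ‖x‖ = 1 }` of a bounded operator
on a complex inner product space. (Here `⟪x, X x⟫_ℂ` is the mathematicians'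
`⟨X x, x⟩`, since Mathlib's inner product is conjugate-linear in the first slot.) -/
def numRadius {E : Type*} [NormedAddCommGroup E] [InnerProductSpace ℂ E]
    (X : E →L[ℂ] E) : ℝ :=
  sSup {r : ℝ | ∃ x : E, ‖x‖ = 1 ∧ r = ‖(⟪x, X x⟫_ℂ : ℂ)‖}

/-- The numerical range `W(X) = { ⟨X x, x⟩ : ‖x‖ = 1 }` of a bounded operator
on a complex inner product space. (Here `⟪x, X x⟫_ℂ` is the mathematicians'
`⟨X x, x⟩`, since Mathlib's inner product is conjugate-linear in the first slot.) -/
def numRange {E : Type*} [NormedAddCommGroup E] [InnerProductSpace ℂ E]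
    (X : E →L[ℂ] E) : Set ℂ :=
  {z : ℂ | ∃ x : E, ‖x‖ = 1 ∧ z = ⟪x, X x⟫_ℂ}

/-- The 2×2 block operator `[[A, B], [C, D]]` acting on the Hilbert space
direct sum `H ⊕₂ H`. -/
def blockOp {H : Type*} [NormedAddCommGroup H] [InnerProductSpace ℂ H]
    (A B C D : H →L[ℂ] H) : WithLp 2 (H × H) →L[ℂ] WithLp 2 (H × H) :=
  ((WithLp.prodContinuousLinearEquiv 2 ℂ H H).symm :
      (H × H) →L[ℂ] WithLp 2 (H × H)) ∘L
    ((A ∘L fst ℂ H H + B ∘L snd ℂ H H).prod (C ∘L fst ℂ H H + D ∘L snd ℂ H H)) ∘L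
    ((WithLp.prodContinuousLinearEquiv 2 ℂ H H) : WithLp 2 (H × H) →L[ℂ] (H × H))

/-- Evaluation of an `n × n` matrix polynomial `F = (p_{ij})` at an operator `T`:
the block operator `(p_{ij}(T))` acting on the `n`-fold Hilbert direct sum `Hⁿ`. -/
def matPolyEval {H : Type*} [NormedAddCommGroup H] [InnerProductSpace ℂ H]
    {n : ℕ} (T : H →L[ℂ] H)
    (F : Matrix (Fin n) (Fin n) (Polynomial ℂ)) :
    (PiLp 2 fun _ : Fin n => H) →L[ℂ] (PiLp 2 fun _ : Fin n => H) :=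
  ((PiLp.continuousLinearEquiv 2 ℂ fun _ : Fin n => H).symm :
      (Fin n → H) →L[ℂ] PiLp 2 fun _ : Fin n => H) ∘L
    (pi fun i => ∑ j, (aeval T (F i j)) ∘L proj j) ∘L
    ((PiLp.continuousLinearEquiv 2 ℂ fun _ : Fin n => H) :
      (PiLp 2 fun _ : Fin n => H) →L[ℂ] (Fin n → H))

/-- The supremum norm `‖F‖_K = sup_{z ∈ K} ‖F(z)‖` of an `n × n` matrix polynomial
over a set `K ⊆ ℂ`, where `‖F(z)‖` is the operator norm of the matrix `F(z)` on `ℂⁿ`. -/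
def matPolyNorm {n : ℕ} (K : Set ℂ) (F : Matrix (Fin n) (Fin n) (Polynomial ℂ)) : ℝ :=
  sSup {r : ℝ | ∃ z ∈ K, r = ‖Matrix.toEuclideanCLM (𝕜 := ℂ) (F.map (Polynomial.eval z))‖}

/-- An operator form of the Diaz–Metcalf inequality. -/
theorem norm_sq_add_mul_norm_sq_le {H : Type*} [NormedAddCommGroup H] [InnerProductSpace ℂ H]
    [CompleteSpace H] {A : H →L[ℂ] H} (hA : IsSelfAdjoint A) {m M : ℝ}
    (hm : ∀ y, m * ‖y‖ ^ 2 ≤ A.reApplyInnerSelf y)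
    (hM : ∀ y, A.reApplyInnerSelf y ≤ M * ‖y‖ ^ 2) (y : H) :
    ‖A y‖ ^ 2 + m * M * ‖y‖ ^ 2 ≤ (m + M) * A.reApplyInnerSelf y := by
  have hscalar (c : ℝ) : IsSelfAdjoint ((c : ℂ) • (1 : H →L[ℂ] H)) := by
    simp [isSelfAdjoint_iff, star_smul]
  have hsmul (c : ℝ) (u v : H) : RCLike.re ⟪(c : ℂ) • u, v⟫_ℂ = c * RCLike.re ⟪u, v⟫_ℂ := by
    simp
  have hself (u : H) : RCLike.re ⟪u, u⟫_ℂ = ‖u‖ ^ 2 := inner_self_eq_norm_sq u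
  have hlower : 0 ≤ A - (m : ℂ) • (1 : H →L[ℂ] H) := by
    rw [nonneg_iff_isPositive, isPositive_def']
    refine ⟨hA.sub (hscalar m), fun z ↦ ?_⟩
    have := hm z
    simp only [reApplyInnerSelf_apply, sub_apply, smul_apply, one_apply_eq_self, inner_sub_left,
      map_sub, hsmul, hself] at this ⊢
    linarith
  have hupper : 0 ≤ (M : ℂ) • (1 : H →L[ℂ] H) - A := by
    rw [nonneg_iff_isPositive, isPositive_def']
    refine ⟨(hscalar M).sub hA, fun z ↦ ?_⟩
    have := hM z
    simp only [reApplyInnerSelf_apply, sub_apply, smul_apply, one_apply_eq_self, inner_sub_left,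
      map_sub, hsmul, hself] at this ⊢
    linarith
  have hcomm : Commute (A - (m : ℂ) • (1 : H →L[ℂ] H)) ((M : ℂ) • (1 : H →L[ℂ] H) - A) := by
    have hA' (c : ℂ) : Commute A (c • (1 : H →L[ℂ] H)) := (Commute.one_right A).smul_right c
    exact ((hA' _).sub_right (Commute.refl A)).sub_left
      ((((Commute.one_right _).smul_right _)).sub_right (hA' _).symm)
  have hprod := (nonneg_iff_isPositive _).mp (Commute.mul_nonneg hlower hupper hcomm)
  have h := hprod.re_inner_nonneg_left y
  have hAA : ⟪A (A y), y⟫_ℂ = ⟪A y, A y⟫_ℂ := hA.isSymmetric (A y) y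
  simp only [mul_apply_eq_comp, sub_apply, smul_apply, one_apply_eq_self, map_sub, map_smul, inner_sub_left,
    hAA, hsmul, hself] at h
  rw [reApplyInnerSelf_apply]
  linarith

/-- The Kantorovich inequality for an invertible operator, with `(S⁻¹)† x` in place of
`(S† S)⁻¹ x`. -/
theorem norm_mul_norm_adjoint_inv_le {H : Type*} [NormedAddCommGroup H] [InnerProductSpace ℂ H]
    [CompleteSpace H] (S : (H →L[ℂ] H)ˣ) (x : H) :
    ‖S.val x‖ * ‖adjoint (S⁻¹).val x‖ ≤
      (1 / 2) * (‖S.val‖ * ‖(S⁻¹).val‖ + (‖S.val‖ * ‖(S⁻¹).val‖)⁻¹) * ‖x‖ ^ 2 := by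
  rcases subsingleton_or_nontrivial H with hH | hH
  · simp [Subsingleton.elim x 0]
  have ha : 0 < ‖S.val‖ := norm_pos_iff.mpr S.ne_zero
  have hb : 0 < ‖(S⁻¹).val‖ := norm_pos_iff.mpr (S⁻¹).ne_zero
  set a := ‖S.val‖
  set b := ‖(S⁻¹).val‖
  set A : H →L[ℂ] H := S.val * adjoint S.val
  have hA : IsSelfAdjoint A := IsSelfAdjoint.mul_star_self S.val
  have hre (y : H) : A.reApplyInnerSelf y = ‖adjoint S.val y‖ ^ 2 := by
    rw [reApplyInnerSelf_apply, mul_apply_eq_comp, ← adjoint_inner_right]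
    exact inner_self_eq_norm_sq _
  have hinv : adjoint S.val * adjoint (S⁻¹).val = 1 := by
    simp only [← star_eq_adjoint, ← star_mul, Units.inv_mul, star_one]
  have hinv' : adjoint (S⁻¹).val * adjoint S.val = 1 := by
    simp only [← star_eq_adjoint, ← star_mul, Units.mul_inv, star_one]
  have hlower (y : H) : b⁻¹ ^ 2 * ‖y‖ ^ 2 ≤ A.reApplyInnerSelf y := by
    rw [hre, ← mul_pow]
    gcongr
    rw [inv_mul_le_iff₀ hb]
    calc ‖y‖ = ‖adjoint (S⁻¹).val (adjoint S.val y)‖ := by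
          rw [← mul_apply_eq_comp, hinv', one_apply_eq_self]
      _ ≤ b * ‖adjoint S.val y‖ := by
          simpa [b] using (adjoint (S⁻¹).val).le_opNorm (adjoint S.val y)
  have hupper (y : H) : A.reApplyInnerSelf y ≤ a ^ 2 * ‖y‖ ^ 2 := by
    rw [hre, ← mul_pow]
    gcongr
    simpa [a] using (adjoint S.val).le_opNorm y
  have hx : adjoint S.val (adjoint (S⁻¹).val x) = x := by
    rw [← mul_apply_eq_comp, hinv, one_apply_eq_self]
  have h := norm_sq_add_mul_norm_sq_le hA hlower hupper (adjoint (S⁻¹).val x)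
  rw [hre, mul_apply_eq_comp, hx] at h
  set p := ‖S.val x‖
  set q := ‖adjoint (S⁻¹).val x‖
  have hpq : 2 * (a / b) * (p * q) ≤ (b⁻¹ ^ 2 + a ^ 2) * ‖x‖ ^ 2 := by
    have hsq := sq_nonneg (p - a / b * q)
    have : b⁻¹ ^ 2 * a ^ 2 * q ^ 2 = (a / b * q) ^ 2 := by ring
    nlinarith
  calc p * q = (b / (2 * a)) * (2 * (a / b) * (p * q)) := by field_simp
    _ ≤ (b / (2 * a)) * ((b⁻¹ ^ 2 + a ^ 2) * ‖x‖ ^ 2) := by gcongr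
    _ = _ := by field_simp; ring

/-- If `‖T‖ ≤ 1` and `‖S‖·‖S⁻¹‖ ≤ C` with `C ≥ 1`, then
`w(S⁻¹ T S) ≤ (1/2)(C + C⁻¹)`. -/
theorem numRadius_conjugate_le {H : Type*} [NormedAddCommGroup H] [InnerProductSpace ℂ H]
    [CompleteSpace H] (T : H →L[ℂ] H) (S : (H →L[ℂ] H)ˣ) (C : ℝ) (hC : 1 ≤ C)
    (hT : ‖T‖ ≤ 1)
    (hS : ‖(S : H →L[ℂ] H)‖ * ‖((S⁻¹ : (H →L[ℂ] H)ˣ) : H →L[ℂ] H)‖ ≤ C) :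
    numRadius (((S⁻¹ : (H →L[ℂ] H)ˣ) : H →L[ℂ] H) * T * (S : H →L[ℂ] H)) ≤
      (1 / 2) * (C + C⁻¹) := by
  have hC0 : 0 < C := zero_lt_one.trans_le hC
  refine Real.sSup_le ?_ (by positivity)
  rintro _ ⟨x, hx, rfl⟩
  have : Nontrivial H := ⟨x, 0, fun h ↦ by simp [h] at hx⟩
  have hκ : 1 ≤ ‖S.val‖ * ‖(S⁻¹).val‖ := by
    simpa using norm_mul_le S.val (S⁻¹).val
  set κ := ‖S.val‖ * ‖(S⁻¹).val‖ with hκ_def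
  have hκ0 : 0 < κ := zero_lt_one.trans_le hκ
  have hmono : κ + κ⁻¹ ≤ C + C⁻¹ := by
    have hfactor : C + C⁻¹ - (κ + κ⁻¹) = (C - κ) * (1 - (C * κ)⁻¹) := by
      field_simp
      ring
    have hinv : (C * κ)⁻¹ ≤ 1 := inv_le_one_of_one_le₀ (one_le_mul_of_one_le_of_one_le hC hκ)
    have := mul_nonneg (sub_nonneg.mpr hS) (sub_nonneg.mpr hinv)
    linarith
  calc ‖⟪x, ((S⁻¹).val * T * S.val) x⟫_ℂ‖
      = ‖⟪adjoint (S⁻¹).val x, T (S.val x)⟫_ℂ‖ := by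
        rw [adjoint_inner_left, mul_apply_eq_comp, mul_apply_eq_comp]
    _ ≤ ‖adjoint (S⁻¹).val x‖ * ‖T (S.val x)‖ := norm_inner_le_norm _ _
    _ ≤ ‖adjoint (S⁻¹).val x‖ * ‖S.val x‖ := by
        gcongr
        exact (T.le_of_opNorm_le hT _).trans_eq (one_mul _)
    _ = ‖S.val x‖ * ‖adjoint (S⁻¹).val x‖ := mul_comm _ _
    _ ≤ (1 / 2) * (κ + κ⁻¹) * ‖x‖ ^ 2 := norm_mul_norm_adjoint_inv_le S x
    _ ≤ (1 / 2) * (C + C⁻¹) := by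
        rw [hx, one_pow, mul_one]
        gcongr

end
end

section
/- Let H be a complex Hilbert space, T a bounded linear operator on H, K ⊆ ℂ a compact set, and C ≥ 1. If ‖F(T)‖ ≤ C · ‖F‖_K for every n ≥ 1 and every n×n matrix polynomial F, then w(F(T)) ≤ (1/2)(C + C⁻¹) · ‖F‖_K for every n ≥ 1 and every n×n matrix polynomial F. -/
open scoped InnerProductSpace
open ContinuousLinearMap Polynomial

noncomputable section

theorem norm_pow_le_one_of_contraction {E : Type*} [NormedAddCommGroup E] [NormedSpace ℂ E]
    {a : E →L[ℂ] E} (ha : ‖a‖ ≤ 1) (N : ℕ) : ‖a ^ N‖ ≤ 1 := by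
  induction N with
  | zero => exact ContinuousLinearMap.norm_id_le
  | succ k ih =>
    rw [pow_succ]
    exact (norm_mul_le _ _).trans (mul_le_one₀ ih (norm_nonneg _) ha)

/-- If `a` is a contraction and `0 ≤ r ≤ 1`, then `‖(a - r) w‖ ≤ ‖(1 - r a) w‖`. -/
theorem norm_sub_smul_le_of_contraction {E : Type*} [NormedAddCommGroup E]
    [InnerProductSpace ℂ E] {a : E →L[ℂ] E} (ha : ‖a‖ ≤ 1) {r : ℝ} (hr0 : 0 ≤ r) (hr1 : r ≤ 1)
    (w : E) : ‖a w - (r : ℂ) • w‖ ≤ ‖w - (r : ℂ) • a w‖ := by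
  have haw : ‖a w‖ ≤ ‖w‖ := a.le_of_opNorm_le_of_le ha le_rfl |>.trans (by simp)
  rw [← sq_le_sq₀ (norm_nonneg _) (norm_nonneg _), @norm_sub_sq ℂ, @norm_sub_sq ℂ,
    inner_smul_right, inner_smul_right, norm_smul, norm_smul]
  have hs : (⟪a w, w⟫_ℂ).re = (⟪w, a w⟫_ℂ).re := inner_re_symm (𝕜 := ℂ) (a w) w
  have h1 : ‖a w‖ ^ 2 ≤ ‖w‖ ^ 2 := by gcongr
  have h2 : r ^ 2 ≤ 1 := by nlinarith
  simp only [RCLike.re_eq_complex_re, Complex.re_ofReal_mul, hs, Complex.norm_real,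
    Real.norm_eq_abs, mul_pow, sq_abs]
  nlinarith

/-- The truncated Neumann series of the Möbius transform `(a - r) (1 - r a)⁻¹` of a
contraction `a` is almost a contraction. -/
theorem norm_mul_geom_sum_le_of_contraction {E : Type*} [NormedAddCommGroup E]
    [InnerProductSpace ℂ E] {a : E →L[ℂ] E} (ha : ‖a‖ ≤ 1) {r : ℝ} (hr0 : 0 ≤ r) (hr1 : r ≤ 1)
    (N : ℕ) :
    ‖(a - (r : ℂ) • 1) * ∑ k ∈ Finset.range N, ((r : ℂ) • a) ^ k‖ ≤ 1 + r ^ N := by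
  refine ContinuousLinearMap.opNorm_le_bound _ (by positivity) fun v => ?_
  set s : E →L[ℂ] E := ∑ k ∈ Finset.range N, ((r : ℂ) • a) ^ k with hs
  have hgeom : (1 - (r : ℂ) • a) * s = 1 - ((r : ℂ) • a) ^ N := mul_neg_geom_sum _ _
  have hpow : ‖((r : ℂ) • a) ^ N‖ ≤ r ^ N := by
    rw [_root_.smul_pow, norm_smul, norm_pow, Complex.norm_real, Real.norm_of_nonneg hr0]
    exact mul_le_of_le_one_right (by positivity) (norm_pow_le_one_of_contraction ha N)
  calc ‖((a - (r : ℂ) • 1) * s) v‖ = ‖a (s v) - (r : ℂ) • s v‖ := by simp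
    _ ≤ ‖s v - (r : ℂ) • a (s v)‖ := norm_sub_smul_le_of_contraction ha hr0 hr1 _
    _ = ‖((1 - (r : ℂ) • a) * s) v‖ := by simp
    _ = ‖v - (((r : ℂ) • a) ^ N) v‖ := by rw [hgeom]; simp
    _ ≤ ‖v‖ + r ^ N * ‖v‖ :=
      (norm_sub_le _ _).trans <| add_le_add le_rfl (ContinuousLinearMap.le_of_opNorm_le _ hpow v)
    _ = (1 + r ^ N) * ‖v‖ := by ring

/-- Passing to the limit in bounds for the truncated Neumann series of the Möbius transform
`(A - r) (1 - r A)⁻¹` of a power bounded operator `A`. -/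
theorem norm_sub_smul_le_of_norm_mul_geom_sum_le {E : Type*} [NormedAddCommGroup E]
    [NormedSpace ℂ E] {A : E →L[ℂ] E} {C r : ℝ} (hr0 : 0 ≤ r) (hr1 : r < 1)
    (hpow : ∀ N : ℕ, ‖A ^ N‖ ≤ C)
    (hsum : ∀ N : ℕ, ‖(A - (r : ℂ) • 1) * ∑ k ∈ Finset.range N, ((r : ℂ) • A) ^ k‖
      ≤ C * (1 + r ^ N)) (x : E) :
    ‖A x - (r : ℂ) • x‖ ≤ C * ‖x - (r : ℂ) • A x‖ := by
  have hr : Filter.Tendsto (fun N : ℕ => r ^ N) Filter.atTop (nhds 0) :=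
    tendsto_pow_atTop_nhds_zero_of_lt_one hr0 hr1
  have h0 : Filter.Tendsto (fun N : ℕ => ((r : ℂ) • A) ^ N) Filter.atTop (nhds 0) := by
    refine squeeze_zero_norm (a := fun N => r ^ N * C) (fun N => ?_) (by simpa using hr.mul_const C)
    rw [_root_.smul_pow, norm_smul, norm_pow, Complex.norm_real, Real.norm_of_nonneg hr0]
    exact mul_le_mul_of_nonneg_left (hpow N) (by positivity)
  have hL : Filter.Tendsto (fun N : ℕ => ‖((A - (r : ℂ) • 1) * (1 - ((r : ℂ) • A) ^ N)) x‖)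
      Filter.atTop (nhds ‖A x - (r : ℂ) • x‖) := by
    have h1 := ((ContinuousLinearMap.apply ℂ E x).continuous.tendsto _).comp
      ((h0.const_sub 1).const_mul (A - (r : ℂ) • 1))
    simpa using h1.norm
  have hR : Filter.Tendsto (fun N : ℕ => C * (1 + r ^ N) * ‖x - (r : ℂ) • A x‖)
      Filter.atTop (nhds (C * ‖x - (r : ℂ) • A x‖)) := by
    simpa using ((hr.const_add 1).const_mul C).mul_const ‖x - (r : ℂ) • A x‖
  refine le_of_tendsto_of_tendsto' hL hR fun N => ?_
  rw [← geom_sum_mul_neg, ← mul_assoc]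
  simpa using ContinuousLinearMap.le_of_opNorm_le _ (hsum N) (x - (r : ℂ) • A x)

/-- The bound at the point `1 / C` of the disc for the Möbius transform of an operator mapping
`x` to `y` controls `⟨y, x⟩`. -/
theorem re_inner_le_of_norm_sub_smul_le {E : Type*} [NormedAddCommGroup E]
    [InnerProductSpace ℂ E] {C : ℝ} (hC : 1 < C) {x y : E} (hx : ‖x‖ = 1)
    (hxy : ‖y - ((C⁻¹ : ℝ) : ℂ) • x‖ ≤ C * ‖x - ((C⁻¹ : ℝ) : ℂ) • y‖) :
    (⟪x, y⟫_ℂ).re ≤ (1 / 2) * (C + C⁻¹) := by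
  have hC0 : 0 < C := by linarith
  have h := pow_le_pow_left₀ (norm_nonneg _) hxy 2
  rw [mul_pow, @norm_sub_sq ℂ, @norm_sub_sq ℂ, inner_smul_right, inner_smul_right, norm_smul,
    norm_smul, hx, Complex.norm_real, Real.norm_of_nonneg (inv_nonneg.2 hC0.le)] at h
  have hs : (⟪y, x⟫_ℂ).re = (⟪x, y⟫_ℂ).re := inner_re_symm (𝕜 := ℂ) y x
  simp only [RCLike.re_eq_complex_re, Complex.re_ofReal_mul, hs] at h
  have hCC : C * C⁻¹ = 1 := mul_inv_cancel₀ hC0.ne'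
  have hlt : C⁻¹ < C := (inv_lt_one_of_one_lt₀ hC).trans hC
  set t := (⟪x, y⟫_ℂ).re
  have e : C ^ 2 * (1 ^ 2 - 2 * (C⁻¹ * t) + (C⁻¹ * ‖y‖) ^ 2) =
      C ^ 2 - 2 * C * t + ‖y‖ ^ 2 := by field_simp
  rw [e] at h
  nlinarith

theorem matPolyEval_apply {H : Type*} [NormedAddCommGroup H] [InnerProductSpace ℂ H]
    {n : ℕ} (T : H →L[ℂ] H) (F : Matrix (Fin n) (Fin n) (Polynomial ℂ))
    (x : PiLp 2 fun _ : Fin n => H) (i : Fin n) :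
    matPolyEval T F x i = ∑ j, aeval T (F i j) (x j) := by
  simp [matPolyEval]

/-- Evaluation of matrix polynomials at an operator, as an algebra homomorphism. -/
def matPolyEvalAlgHom {H : Type*} [NormedAddCommGroup H] [InnerProductSpace ℂ H]
    (n : ℕ) (T : H →L[ℂ] H) : Matrix (Fin n) (Fin n) (Polynomial ℂ) →ₐ[ℂ]
      ((PiLp 2 fun _ : Fin n => H) →L[ℂ] (PiLp 2 fun _ : Fin n => H)) :=
  AlgHom.ofLinearMap
    { toFun := matPolyEval T
      map_add' := fun F G => by
        ext x i
        simp [matPolyEval_apply, Finset.sum_add_distrib]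
      map_smul' := fun c F => by
        ext x i
        simp [matPolyEval_apply, Finset.smul_sum] }
    (by
      ext x i
      simp only [LinearMap.coe_mk, AddHom.coe_mk, matPolyEval_apply]
      rw [Finset.sum_eq_single i (fun j _ hj => by simp [Matrix.one_apply_ne hj.symm]) (by simp)]
      simp)
    (fun F G => by
      ext x i
      simp only [LinearMap.coe_mk, AddHom.coe_mk, mul_apply_eq_comp,
        matPolyEval_apply, Matrix.mul_apply, map_sum, map_mul, sum_apply]
      exact Finset.sum_comm)

/-- Evaluation of matrix polynomials at a point, as an algebra homomorphism into operators. -/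
def matPolyPointEval (n : ℕ) (z : ℂ) : Matrix (Fin n) (Fin n) (Polynomial ℂ) →ₐ[ℂ]
    (EuclideanSpace ℂ (Fin n) →L[ℂ] EuclideanSpace ℂ (Fin n)) :=
  (Matrix.toEuclideanCLM (n := Fin n) (𝕜 := ℂ)).toAlgEquiv.toAlgHom.comp (aeval z).mapMatrix

theorem matPolyPointEval_apply {n : ℕ} (z : ℂ) (F : Matrix (Fin n) (Fin n) (Polynomial ℂ)) :
    matPolyPointEval n z F = Matrix.toEuclideanCLM (𝕜 := ℂ) (F.map (Polynomial.eval z)) := rfl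

theorem norm_matPolyPointEval_le {n : ℕ} {K : Set ℂ} (hK : IsCompact K)
    (F : Matrix (Fin n) (Fin n) (Polynomial ℂ)) {z : ℂ} (hz : z ∈ K) :
    ‖matPolyPointEval n z F‖ ≤ matPolyNorm K F := by
  have hcont : Continuous fun z : ℂ =>
      ‖Matrix.toEuclideanCLM (𝕜 := ℂ) (F.map (Polynomial.eval z))‖ := by
    have h1 : Continuous (Matrix.toEuclideanCLM (n := Fin n) (𝕜 := ℂ)) :=
      LinearMap.continuous_of_finiteDimensional
        (Matrix.toEuclideanCLM (n := Fin n) (𝕜 := ℂ)).toAlgEquiv.toLinearMap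
    refine (h1.comp (continuous_matrix fun i j => ?_)).norm
    exact (F i j).continuous
  refine le_csSup ?_ ⟨z, hz, rfl⟩
  obtain ⟨B, hB⟩ := (hK.image hcont).bddAbove
  exact ⟨B, by rintro _ ⟨w, hw, rfl⟩; exact hB ⟨w, hw, rfl⟩⟩

theorem matPolyNorm_le {n : ℕ} {K : Set ℂ} {F : Matrix (Fin n) (Fin n) (Polynomial ℂ)} {B : ℝ}
    (hB : 0 ≤ B) (h : ∀ z ∈ K, ‖matPolyPointEval n z F‖ ≤ B) : matPolyNorm K F ≤ B :=
  Real.sSup_le (by rintro _ ⟨z, hz, rfl⟩; exact h z hz) hB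

theorem matPolyNorm_nonneg {n : ℕ} (K : Set ℂ) (F : Matrix (Fin n) (Fin n) (Polynomial ℂ)) :
    0 ≤ matPolyNorm K F :=
  Real.sSup_nonneg (by rintro _ ⟨z, hz, rfl⟩; exact norm_nonneg _)

/-- The numerical range bound for a matrix polynomial that is contractive on `K`. -/
theorem re_inner_matPolyEval_le {H : Type*} [NormedAddCommGroup H] [InnerProductSpace ℂ H]
    {n : ℕ} {T : H →L[ℂ] H} {K : Set ℂ} {C : ℝ} (hC : 1 ≤ C)
    (h : ∀ F : Matrix (Fin n) (Fin n) (Polynomial ℂ), ‖matPolyEval T F‖ ≤ C * matPolyNorm K F)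
    {G : Matrix (Fin n) (Fin n) (Polynomial ℂ)} (hG : ∀ z ∈ K, ‖matPolyPointEval n z G‖ ≤ 1)
    {x : PiLp 2 fun _ : Fin n => H} (hx : ‖x‖ = 1) :
    (⟪x, matPolyEval T G x⟫_ℂ).re ≤ (1 / 2) * (C + C⁻¹) := by
  have hC0 : 0 < C := by linarith
  have bound : ∀ (F : Matrix (Fin n) (Fin n) (Polynomial ℂ)) (B : ℝ), 0 ≤ B →
      (∀ z ∈ K, ‖matPolyPointEval n z F‖ ≤ B) → ‖matPolyEvalAlgHom n T F‖ ≤ C * B :=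
    fun F B hB hF => (h F).trans (mul_le_mul_of_nonneg_left (matPolyNorm_le hB hF) hC0.le)
  change (⟪x, matPolyEvalAlgHom n T G x⟫_ℂ).re ≤ _
  rcases hC.eq_or_lt with rfl | hC1
  · have h1 := bound G 1 zero_le_one hG
    calc (⟪x, matPolyEvalAlgHom n T G x⟫_ℂ).re
        ≤ ‖x‖ * ‖matPolyEvalAlgHom n T G x‖ := re_inner_le_norm (𝕜 := ℂ) _ _
      _ ≤ 1 * (1 * 1 * ‖x‖) := by
        rw [hx]
        have h2 := ContinuousLinearMap.le_of_opNorm_le _ h1 x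
        rw [hx] at h2
        linarith
      _ = (1 / 2) * (1 + 1⁻¹) := by rw [hx]; norm_num
  · have hr0 : 0 ≤ C⁻¹ := inv_nonneg.2 hC0.le
    have hr1 : C⁻¹ < 1 := inv_lt_one_of_one_lt₀ hC1
    refine re_inner_le_of_norm_sub_smul_le hC1 hx
      (norm_sub_smul_le_of_norm_mul_geom_sum_le hr0 hr1 (fun N => ?_) (fun N => ?_) x)
    · rw [← map_pow, ← mul_one C]
      refine bound _ _ zero_le_one fun z hz => ?_
      rw [map_pow]
      exact norm_pow_le_one_of_contraction (hG z hz) N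
    · have := bound ((G - ((C⁻¹ : ℝ) : ℂ) • 1) *
        ∑ k ∈ Finset.range N, (((C⁻¹ : ℝ) : ℂ) • G) ^ k) (1 + C⁻¹ ^ N) (by positivity)
        fun z hz => by
          simpa only [map_mul, map_sub, map_smul, map_one, map_sum, map_pow] using
            norm_mul_geom_sum_le_of_contraction (hG z hz) hr0 hr1.le N
      simpa only [map_mul, map_sub, map_smul, map_one, map_sum, map_pow] using this

/-- If `K` is a complete `C`-spectral set for `T`, then `K` is a complete
`(1/2)(C + C⁻¹)`-numerical radius set for `T`. -/
theorem numRadius_le_of_complete_spectral_set {H : Type*} [NormedAddCommGroup H]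
    [InnerProductSpace ℂ H] [CompleteSpace H] (T : H →L[ℂ] H) (K : Set ℂ)
    (hK : IsCompact K) (C : ℝ) (hC : 1 ≤ C)
    (h : ∀ n : ℕ, 1 ≤ n → ∀ F : Matrix (Fin n) (Fin n) (Polynomial ℂ),
      ‖matPolyEval T F‖ ≤ C * matPolyNorm K F) :
    ∀ n : ℕ, 1 ≤ n → ∀ F : Matrix (Fin n) (Fin n) (Polynomial ℂ),
      numRadius (matPolyEval T F) ≤ (1 / 2) * (C + C⁻¹) * matPolyNorm K F := by
  intro n hn F
  have hM := matPolyNorm_nonneg K F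
  have hC0 : 0 < C := by linarith
  set M := matPolyNorm K F with hMdef
  refine Real.sSup_le ?_ (by positivity)
  rintro _ ⟨x, hx, rfl⟩
  rcases hM.eq_or_lt with hM0 | hM0
  · have h0 : ‖matPolyEval T F‖ ≤ 0 := by simpa [← hMdef, ← hM0] using h n hn F
    simp [norm_le_zero_iff.1 h0, ← hM0]
  obtain ⟨c, hc, hcx⟩ := RCLike.exists_norm_eq_mul_self (⟪x, matPolyEval T F x⟫_ℂ)
  have key := re_inner_matPolyEval_le (G := (c * (M : ℂ)⁻¹) • F) hC (h n hn) (fun z hz => by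
    rw [map_smul, norm_smul, norm_mul, hc, one_mul, norm_inv, Complex.norm_real,
      Real.norm_of_nonneg hM, inv_mul_le_iff₀ hM0, mul_one]
    exact norm_matPolyPointEval_le hK F hz) hx
  have hval : ⟪x, matPolyEval T ((c * (M : ℂ)⁻¹) • F) x⟫_ℂ =
      ((M⁻¹ * ‖⟪x, matPolyEval T F x⟫_ℂ‖ : ℝ) : ℂ) := by
    have hsmul : matPolyEval T ((c * (M : ℂ)⁻¹) • F) = (c * (M : ℂ)⁻¹) • matPolyEval T F :=
      map_smul (matPolyEvalAlgHom n T) _ _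
    rw [hsmul, smul_apply, inner_smul_right, mul_right_comm]
    push_cast
    rw [mul_comm]
    exact congrArg _ hcx.symm
  rw [hval, Complex.ofReal_re, inv_mul_le_iff₀ hM0] at key
  linarith

end
end

section
/- Let H be a complex Hilbert space, T a bounded linear operator on H, and ρ ≥ 1. Suppose there exists an invertible bounded operator S on H with ‖S⁻¹ T S‖ ≤ 1 and ‖S‖·‖S⁻¹‖ ≤ ρ. Then for every n ≥ 1 and every n×n matrix polynomial F, w(F(T)) ≤ (1/2)(ρ + ρ⁻¹) · ‖F‖_{D̄}, where D̄ is the closed unit disc in ℂ. -/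
open scoped InnerProductSpace
open ContinuousLinearMap Polynomial

noncomputable section

namespace VonNeumannInequality

variable {H : Type*} [NormedAddCommGroup H] [InnerProductSpace ℂ H]

/-- Parseval's identity for the discrete Fourier transform of vector-valued functions. -/
lemma sum_norm_sq_dft {N : ℕ} [NeZero N] (u : ZMod N → H) :
    ∑ k, ‖ZMod.dft u k‖ ^ 2 = N * ∑ j, ‖u j‖ ^ 2 := by
  have key : ∑ k, ⟪ZMod.dft u k, ZMod.dft u k⟫_ℂ = N * ∑ j, ⟪u j, u j⟫_ℂ := by
    calc ∑ k, ⟪ZMod.dft u k, ZMod.dft u k⟫_ℂ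
        = ∑ k, ∑ j, ⟪u j, ZMod.stdAddChar (-(k * -j)) • ZMod.dft u k⟫_ℂ := by
          refine Finset.sum_congr rfl fun k _ => ?_
          generalize hv : ZMod.dft u k = v
          nth_rewrite 1 [← hv]
          rw [ZMod.dft_apply, sum_inner]
          simp only [inner_smul_left, inner_smul_right,
            ← AddChar.map_neg_eq_conj, neg_neg, mul_neg, mul_comm]
      _ = ∑ j, ⟪u j, ZMod.dft (ZMod.dft u) (-j)⟫_ℂ := by
          rw [Finset.sum_comm]
          simp only [ZMod.dft_apply (ZMod.dft u), inner_sum]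
      _ = N * ∑ j, ⟪u j, u j⟫_ℂ := by
          simp only [ZMod.dft_dft, neg_neg, inner_smul_right, Finset.mul_sum]
  simp only [inner_self_eq_norm_sq_to_K] at key
  refine Complex.ofReal_injective ?_
  push_cast
  exact key

/-- A scalar matrix acts on tuples of vectors with norm at most its operator norm. -/
lemma sum_norm_sq_matrix_smul_le {n : ℕ} (A : Matrix (Fin n) (Fin n) ℂ) (v : Fin n → H) :
    ∑ i, ‖∑ j, A i j • v j‖ ^ 2 ≤
      ‖Matrix.toEuclideanCLM (𝕜 := ℂ) A‖ ^ 2 * ∑ j, ‖v j‖ ^ 2 := by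
  let V := Submodule.span ℂ (Set.range v)
  have : FiniteDimensional ℂ V := FiniteDimensional.span_of_finite ℂ (Set.finite_range v)
  let b := stdOrthonormalBasis ℂ V
  let v' : Fin n → V := fun j => ⟨v j, Submodule.subset_span ⟨j, rfl⟩⟩
  let c e : EuclideanSpace ℂ (Fin n) := WithLp.toLp 2 fun j => ⟪b e, v' j⟫_ℂ
  have hw (i) : ‖∑ j, A i j • v j‖ ^ 2 = ∑ e, ‖Matrix.toEuclideanCLM (𝕜 := ℂ) A (c e) i‖ ^ 2 := by
    have h1 : ‖∑ j, A i j • v j‖ = ‖∑ j, A i j • v' j‖ := by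
      rw [← Submodule.norm_coe]; simp [v']
    rw [h1, ← b.sum_sq_norm_inner_right]
    simp [Matrix.mulVec, dotProduct, c, inner_sum, inner_smul_right]
  have hv (j) : ‖v j‖ ^ 2 = ∑ e, ‖c e j‖ ^ 2 := (b.sum_sq_norm_inner_right (v' j)).symm
  simp only [hw, hv]
  rw [Finset.sum_comm, Finset.sum_comm (γ := Fin n), Finset.mul_sum]
  refine Finset.sum_le_sum fun e _ => ?_
  rw [← EuclideanSpace.norm_sq_eq, ← EuclideanSpace.norm_sq_eq, ← mul_pow]
  gcongr
  exact ContinuousLinearMap.le_opNorm _ _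

/-- Convolution on `ZMod N` with the coefficients of a matrix polynomial is bounded in `ℓ²`
by any bound for the matrix polynomial on the unit circle. -/
lemma sum_norm_sq_cyclic_le {N n d : ℕ} [NeZero N] (F : Matrix (Fin n) (Fin n) ℂ[X])
    (hd : ∀ i j, (F i j).natDegree < d) {M : ℝ}
    (hM : ∀ z : ℂ, ‖z‖ ≤ 1 → ‖Matrix.toEuclideanCLM (𝕜 := ℂ) (F.map (eval z))‖ ≤ M)
    (u : Fin n → ZMod N → H) :
    ∑ j, ∑ i, ‖∑ i', ∑ l ∈ Finset.range d, (F i i').coeff l • u i' (j + l)‖ ^ 2 ≤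
      M ^ 2 * ∑ j, ∑ i, ‖u i j‖ ^ 2 := by
  let w : Fin n → ZMod N → H := fun i j =>
    ∑ i', ∑ l ∈ Finset.range d, (F i i').coeff l • u i' (j + l)
  have hshift (f : ZMod N → H) (l : ℕ) (k : ZMod N) :
      ZMod.dft (fun j => f (j + (l : ZMod N))) k = ZMod.stdAddChar k ^ l • ZMod.dft f k := by
    rw [ZMod.dft_apply, ZMod.dft_apply, Finset.smul_sum,
      ← Equiv.sum_comp (Equiv.addRight (l : ZMod N)) (fun j => _ • _ • f j)]
    refine Finset.sum_congr rfl fun j _ => ?_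
    rw [smul_smul, ← AddChar.map_nsmul_eq_pow, ← AddChar.map_add_eq_mul]
    congr 2
    simp only [Equiv.coe_addRight, nsmul_eq_mul]
    ring
  have hdft (i) (k) : ZMod.dft (w i) k =
      ∑ i', F.map (eval (ZMod.stdAddChar k)) i i' • ZMod.dft (u i') k := by
    have : w i = ∑ i', ∑ l ∈ Finset.range d, (F i i').coeff l • fun j => u i' (j + l) := by
      ext j; simp [w]
    rw [this]
    simp only [map_sum, map_smul, Finset.sum_apply, Pi.smul_apply, hshift, smul_smul,
      Matrix.map_apply, eval_eq_sum_range' (hd i _), Finset.sum_smul]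
  have hN : (0 : ℝ) < N := by exact_mod_cast NeZero.pos N
  refine le_of_mul_le_mul_left ?_ hN
  calc (N : ℝ) * ∑ j, ∑ i, ‖w i j‖ ^ 2
      = ∑ k, ∑ i, ‖ZMod.dft (w i) k‖ ^ 2 := by
        rw [Finset.sum_comm, Finset.sum_comm (γ := ZMod N)]
        simp only [sum_norm_sq_dft, Finset.mul_sum]
    _ ≤ ∑ k, M ^ 2 * ∑ i, ‖ZMod.dft (u i) k‖ ^ 2 := by
        refine Finset.sum_le_sum fun k _ => ?_
        simp only [hdft]
        refine (sum_norm_sq_matrix_smul_le _ _).trans ?_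
        gcongr
        exact hM _ (AddChar.norm_apply _ _).le
    _ = N * (M ^ 2 * ∑ j, ∑ i, ‖u i j‖ ^ 2) := by
        rw [← Finset.mul_sum, Finset.sum_comm, Finset.sum_comm (γ := ZMod N)]
        simp only [sum_norm_sq_dft, ← Finset.mul_sum]
        ring

lemma aeval_conj (S : (H →L[ℂ] H)ˣ) (T : H →L[ℂ] H) (p : ℂ[X]) :
    aeval T p = (S : H →L[ℂ] H) *
      aeval (((S⁻¹ : (H →L[ℂ] H)ˣ) : H →L[ℂ] H) * T * (S : H →L[ℂ] H)) p *
        ((S⁻¹ : (H →L[ℂ] H)ˣ) : H →L[ℂ] H) := by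
  have hpow (k : ℕ) := Units.conj_pow S⁻¹ T k
  simp only [inv_inv] at hpow
  simp only [aeval_eq_sum_range, hpow, Finset.mul_sum, Finset.sum_mul, mul_smul_comm,
    smul_mul_assoc]
  simp only [mul_assoc, Units.mul_inv, Units.mul_inv_cancel_left, mul_one]

variable [CompleteSpace H]

lemma nonneg_of_re_inner_nonneg {A : H →L[ℂ] H} (hA : IsSelfAdjoint A)
    (h : ∀ x, 0 ≤ (⟪x, A x⟫_ℂ).re) : 0 ≤ A := by
  rw [ContinuousLinearMap.nonneg_iff_isPositive, ContinuousLinearMap.isPositive_def']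
  refine ⟨hA, fun x => ?_⟩
  rw [ContinuousLinearMap.reApplyInnerSelf_apply, inner_re_symm]
  exact h x

/-- The defect operator of a contraction. -/
lemma exists_norm_sq_eq_sub {C : H →L[ℂ] H} (hC : ‖C‖ ≤ 1) :
    ∃ D : H →L[ℂ] H, ∀ x, ‖D x‖ ^ 2 = ‖x‖ ^ 2 - ‖C x‖ ^ 2 := by
  have hre (A : H →L[ℂ] H) (x : H) : (⟪x, (star A * A) x⟫_ℂ).re = ‖A x‖ ^ 2 := by
    rw [ContinuousLinearMap.star_eq_adjoint, mul_apply_eq_comp,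
      ContinuousLinearMap.adjoint_inner_right]
    exact inner_self_eq_norm_sq (𝕜 := ℂ) _
  have hsub (x : H) : (⟪x, (1 - star C * C) x⟫_ℂ).re = ‖x‖ ^ 2 - ‖C x‖ ^ 2 := by
    rw [sub_apply, inner_sub_right, Complex.sub_re, hre]
    congr 1
    exact inner_self_eq_norm_sq (𝕜 := ℂ) _
  have h0 : 0 ≤ 1 - star C * C := by
    refine nonneg_of_re_inner_nonneg (.sub (.one _) (.star_mul_self C)) fun x => ?_
    rw [hsub, sub_nonneg]
    gcongr
    exact C.le_of_opNorm_le hC x |>.trans_eq (one_mul _)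
  obtain ⟨D, hD⟩ := CStarAlgebra.nonneg_iff_eq_star_mul_self.mp h0
  exact ⟨D, fun x => by rw [← hre, ← hsub, hD]⟩

/-- An operator form of the Kantorovich inequality. -/
lemma kantorovich (S : (H →L[ℂ] H)ˣ) (y : H) :
    ‖((S⁻¹ : (H →L[ℂ] H)ˣ) : H →L[ℂ] H)‖ ^ 2 * ‖star (S : H →L[ℂ] H) ((S : H →L[ℂ] H) y)‖ ^ 2 +
        ‖(S : H →L[ℂ] H)‖ ^ 2 * ‖y‖ ^ 2 ≤
      ((‖(S : H →L[ℂ] H)‖ * ‖((S⁻¹ : (H →L[ℂ] H)ˣ) : H →L[ℂ] H)‖) ^ 2 + 1) *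
        ‖(S : H →L[ℂ] H) y‖ ^ 2 := by
  set s := ‖(S : H →L[ℂ] H)‖
  set t := ‖((S⁻¹ : (H →L[ℂ] H)ˣ) : H →L[ℂ] H)‖
  set A : H →L[ℂ] H := (S : H →L[ℂ] H) with hA
  set B : H →L[ℂ] H := star A * A with hB
  have hBsa : IsSelfAdjoint B := .star_mul_self A
  have hxx (x : H) : (⟪x, x⟫_ℂ).re = ‖x‖ ^ 2 := inner_self_eq_norm_sq (𝕜 := ℂ) _
  have hre (x : H) : (⟪x, B x⟫_ℂ).re = ‖A x‖ ^ 2 := by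
    rw [hB, ContinuousLinearMap.star_eq_adjoint, mul_apply_eq_comp,
      ContinuousLinearMap.adjoint_inner_right, hxx]
  have hsmul (r : ℝ) (x y : H) : (⟪x, r • y⟫_ℂ).re = r * (⟪x, y⟫_ℂ).re := by
    rw [← Complex.coe_smul, inner_smul_right, Complex.re_ofReal_mul]
  have h1 : 0 ≤ s ^ 2 • (1 : H →L[ℂ] H) - B := by
    refine nonneg_of_re_inner_nonneg (.sub (.smul (.all _) (.one _)) hBsa) fun x => ?_
    rw [sub_apply, inner_sub_right, Complex.sub_re, hre,
      smul_apply, hsmul, one_apply_eq_self, hxx, ← mul_pow,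
      sub_nonneg]
    gcongr
    exact A.le_opNorm x
  have h2 : 0 ≤ t ^ 2 • B - (1 : H →L[ℂ] H) := by
    refine nonneg_of_re_inner_nonneg (.sub (.smul (.all _) hBsa) (.one _)) fun x => ?_
    rw [sub_apply, inner_sub_right, Complex.sub_re,
      smul_apply, hsmul, hre, one_apply_eq_self, hxx, ← mul_pow,
      sub_nonneg]
    gcongr
    have : ((S⁻¹ : (H →L[ℂ] H)ˣ) : H →L[ℂ] H) (A x) = x := by
      rw [hA, ← mul_apply_eq_comp, Units.inv_mul, one_apply_eq_self]
    conv_lhs => rw [← this]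
    exact ContinuousLinearMap.le_opNorm _ _
  have hcomm : Commute (s ^ 2 • (1 : H →L[ℂ] H) - B) (t ^ 2 • B - (1 : H →L[ℂ] H)) :=
    .sub_left (.smul_left (.one_left _) _)
      (.sub_right (.smul_right (.refl _) _) (.one_right _))
  have h3 := (ContinuousLinearMap.nonneg_iff_isPositive _).mp (Commute.mul_nonneg h1 h2 hcomm)
  have h4 := h3.re_inner_nonneg_right y
  have h5 : (s ^ 2 • (1 : H →L[ℂ] H) - B) * (t ^ 2 • B - (1 : H →L[ℂ] H)) =
      (s ^ 2 * t ^ 2 + 1) • B - s ^ 2 • 1 - t ^ 2 • (B * B) := by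
    simp only [sub_mul, mul_sub, smul_mul_assoc, mul_smul_comm, one_mul, mul_one]
    module
  have h6 : (⟪y, (B * B) y⟫_ℂ).re = ‖star A (A y)‖ ^ 2 := by
    rw [mul_apply_eq_comp, ← hxx]
    nth_rewrite 1 [← hBsa.star_eq]
    rw [ContinuousLinearMap.star_eq_adjoint, ContinuousLinearMap.adjoint_inner_right]
    rfl
  rw [h5] at h4
  simp only [sub_apply, inner_sub_right, smul_apply, RCLike.re_eq_complex_re] at h4
  rw [Complex.sub_re, Complex.sub_re, hsmul, hsmul, hsmul, h6, hre,
    one_apply_eq_self, hxx] at h4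
  nlinarith

/-- Von Neumann's inequality for matrix polynomials, for strict contractions. -/
lemma sum_norm_sq_aeval_le_of_norm_lt_one {C : H →L[ℂ] H} (hC : ‖C‖ < 1) {n : ℕ}
    (F : Matrix (Fin n) (Fin n) ℂ[X]) {M : ℝ}
    (hM : ∀ z : ℂ, ‖z‖ ≤ 1 → ‖Matrix.toEuclideanCLM (𝕜 := ℂ) (F.map (eval z))‖ ≤ M)
    (x : Fin n → H) :
    ∑ i, ‖∑ j, aeval C (F i j) (x j)‖ ^ 2 ≤ M ^ 2 * ∑ j, ‖x j‖ ^ 2 := by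
  obtain ⟨D, hD⟩ := exists_norm_sq_eq_sub hC.le
  obtain ⟨d, hd⟩ : ∃ d, ∀ i j, (F i j).natDegree < d + 1 :=
    ⟨∑ i, ∑ j, (F i j).natDegree, fun i j => Nat.lt_succ_of_le <|
      (Finset.single_le_sum (f := fun j => (F i j).natDegree) (fun _ _ => Nat.zero_le _)
        (Finset.mem_univ j)).trans
      (Finset.single_le_sum (f := fun i => ∑ j, (F i j).natDegree) (fun _ _ => Nat.zero_le _)
        (Finset.mem_univ i))⟩
  set y : Fin n → H := fun i => ∑ j, aeval C (F i j) (x j) with hy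
  have hDsum (v : H) (L : ℕ) :
      ∑ j ∈ Finset.range L, ‖D ((C ^ j) v)‖ ^ 2 = ‖v‖ ^ 2 - ‖(C ^ L) v‖ ^ 2 := by
    simp only [hD]
    simp only [← mul_apply_eq_comp, ← pow_succ']
    rw [Finset.sum_range_sub' (fun j => ‖(C ^ j) v‖ ^ 2)]
    simp
  have hCy (i) (j : ℕ) : D ((C ^ j) (y i)) = ∑ i', ∑ l ∈ Finset.range (d + 1),
      (F i i').coeff l • D ((C ^ (j + l)) (x i')) := by
    simp only [hy, map_sum, aeval_eq_sum_range' (hd i _), sum_apply, smul_apply, map_smul,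
      pow_add, mul_apply_eq_comp]
  have hL (L : ℕ) : ∑ i, ‖y i‖ ^ 2 - ∑ i, ‖(C ^ L) (y i)‖ ^ 2 ≤ M ^ 2 * ∑ j, ‖x j‖ ^ 2 := by
    let u : Fin n → ZMod (L + d + 1) → H := fun i j => D ((C ^ j.val) (x i))
    have hsum (f : ℕ → ℝ) :
        ∑ j : ZMod (L + d + 1), f j.val = ∑ j ∈ Finset.range (L + d + 1), f j :=
      Fin.sum_univ_eq_sum_range f (L + d + 1)
    have hu : ∑ j, ∑ i, ‖u i j‖ ^ 2 ≤ ∑ i, ‖x i‖ ^ 2 := by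
      rw [Finset.sum_comm]
      refine Finset.sum_le_sum fun i _ => ?_
      rw [hsum fun j => ‖D ((C ^ j) (x i))‖ ^ 2, hDsum]
      exact sub_le_self _ (sq_nonneg _)
    calc ∑ i, ‖y i‖ ^ 2 - ∑ i, ‖(C ^ L) (y i)‖ ^ 2
        = ∑ j ∈ Finset.range L, ∑ i, ‖D ((C ^ j) (y i))‖ ^ 2 := by
          rw [Finset.sum_comm, ← Finset.sum_sub_distrib]
          simp only [hDsum]
      _ = ∑ j ∈ Finset.range L, ∑ i, ‖∑ i', ∑ l ∈ Finset.range (d + 1),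
            (F i i').coeff l • u i' ((j : ZMod (L + d + 1)) + l)‖ ^ 2 := by
          refine Finset.sum_congr rfl fun j hj => Finset.sum_congr rfl fun i _ => ?_
          rw [hCy]
          congr 2
          refine Finset.sum_congr rfl fun i' _ => Finset.sum_congr rfl fun l hl => ?_
          rw [Finset.mem_range] at hj hl
          simp only [u]
          rw [← Nat.cast_add, ZMod.val_cast_of_lt (by lia)]
      _ ≤ ∑ j ∈ Finset.range (L + d + 1), ∑ i, ‖∑ i', ∑ l ∈ Finset.range (d + 1),
            (F i i').coeff l • u i' ((j : ZMod (L + d + 1)) + l)‖ ^ 2 :=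
          Finset.sum_le_sum_of_subset_of_nonneg (Finset.range_mono (by lia))
            fun _ _ _ => by positivity
      _ = ∑ j, ∑ i, ‖∑ i', ∑ l ∈ Finset.range (d + 1),
            (F i i').coeff l • u i' (j + l)‖ ^ 2 := by
          rw [← hsum fun j => ∑ i, ‖∑ i', ∑ l ∈ Finset.range (d + 1),
            (F i i').coeff l • u i' ((j : ZMod (L + d + 1)) + l)‖ ^ 2]
          simp only [ZMod.natCast_zmod_val]
      _ ≤ M ^ 2 * ∑ j, ∑ i, ‖u i j‖ ^ 2 := sum_norm_sq_cyclic_le F hd hM u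
      _ ≤ M ^ 2 * ∑ j, ‖x j‖ ^ 2 := by gcongr
  have hlim : Filter.Tendsto (fun L : ℕ => ∑ i, ‖y i‖ ^ 2 - ∑ i, ‖(C ^ L) (y i)‖ ^ 2)
      Filter.atTop (nhds (∑ i, ‖y i‖ ^ 2 - ∑ i, ‖(0 : H →L[ℂ] H) (y i)‖ ^ 2)) := by
    refine tendsto_const_nhds.sub (tendsto_finsetSum _ fun i _ => ?_)
    exact (((ContinuousLinearMap.apply ℂ H (y i)).continuous.tendsto _).comp
      (tendsto_pow_atTop_nhds_zero_of_norm_lt_one hC)).norm.pow 2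
  simpa using le_of_tendsto' hlim hL

/-- Von Neumann's inequality for matrix polynomials. -/
lemma sum_norm_sq_aeval_le {C : H →L[ℂ] H} (hC : ‖C‖ ≤ 1) {n : ℕ}
    (F : Matrix (Fin n) (Fin n) ℂ[X]) {M : ℝ}
    (hM : ∀ z : ℂ, ‖z‖ ≤ 1 → ‖Matrix.toEuclideanCLM (𝕜 := ℂ) (F.map (eval z))‖ ≤ M)
    (x : Fin n → H) :
    ∑ i, ‖∑ j, aeval C (F i j) (x j)‖ ^ 2 ≤ M ^ 2 * ∑ j, ‖x j‖ ^ 2 := by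
  have hcont : Continuous fun r : ℝ =>
      ∑ i, ‖∑ j, aeval ((r : ℂ) • C) (F i j) (x j)‖ ^ 2 := by
    refine continuous_finsetSum _ fun i _ => .pow (.norm (continuous_finsetSum _ fun j _ => ?_)) 2
    exact (ContinuousLinearMap.apply ℂ H (x j)).continuous.comp
      ((Polynomial.continuous_aeval (F i j)).comp (by fun_prop))
  have hlim := (hcont.tendsto 1).mono_left (nhdsWithin_le_nhds (s := Set.Iio 1))
  simp only [Complex.ofReal_one, one_smul] at hlim
  refine le_of_tendsto hlim ?_
  filter_upwards [Ioo_mem_nhdsLT (zero_lt_one' ℝ)] with r hr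
  refine sum_norm_sq_aeval_le_of_norm_lt_one ?_ F hM x
  rw [norm_smul, Complex.norm_of_nonneg hr.1.le]
  exact (mul_le_of_le_one_right hr.1.le hC).trans_lt hr.2

lemma norm_le_matPolyNorm {n : ℕ} (F : Matrix (Fin n) (Fin n) ℂ[X]) {K : Set ℂ}
    (hK : IsCompact K) {z : ℂ} (hz : z ∈ K) :
    ‖Matrix.toEuclideanCLM (𝕜 := ℂ) (F.map (eval z))‖ ≤ matPolyNorm K F := by
  have hcont : Continuous fun z : ℂ => ‖Matrix.toEuclideanCLM (𝕜 := ℂ) (F.map (eval z))‖ := by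
    have h : Continuous (Matrix.toEuclideanCLM (n := Fin n) (𝕜 := ℂ)) :=
      LinearMap.continuous_of_finiteDimensional
        (Matrix.toEuclideanCLM (n := Fin n) (𝕜 := ℂ)).toAlgEquiv.toLinearMap
    refine (h.comp (continuous_matrix fun i j => ?_)).norm
    exact (F i j).continuous
  refine le_csSup ((hK.bddAbove_image hcont.continuousOn).mono ?_) ⟨z, hz, rfl⟩
  rintro _ ⟨w, hw, rfl⟩
  exact ⟨w, hw, rfl⟩

lemma add_inv_le_add_inv {a b : ℝ} (ha : 1 ≤ a) (hab : a ≤ b) : a + a⁻¹ ≤ b + b⁻¹ := by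
  have ha0 : 0 < a := by linarith
  have hb0 : 0 < b := by linarith
  have h : b + b⁻¹ - (a + a⁻¹) = (b - a) * (b * a - 1) / (b * a) := by
    field_simp
    ring
  rw [← sub_nonneg, h]
  exact div_nonneg (mul_nonneg (by linarith) (by nlinarith)) (by positivity)

end VonNeumannInequality

open VonNeumannInequality

/-- If `T` is similar to a contraction via `S` with `‖S‖·‖S⁻¹‖ ≤ ρ`, then
`w(F(T)) ≤ (1/2)(ρ + ρ⁻¹)·‖F‖_{D̄}` for every matrix polynomial `F`. -/
theorem numRadius_matPolyEval_le_of_similarity {H : Type*} [NormedAddCommGroup H]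
    [InnerProductSpace ℂ H] [CompleteSpace H] (T : H →L[ℂ] H) (ρ : ℝ) (hρ : 1 ≤ ρ)
    (h : ∃ S : (H →L[ℂ] H)ˣ,
      ‖((S⁻¹ : (H →L[ℂ] H)ˣ) : H →L[ℂ] H) * T * (S : H →L[ℂ] H)‖ ≤ 1 ∧
      ‖(S : H →L[ℂ] H)‖ * ‖((S⁻¹ : (H →L[ℂ] H)ˣ) : H →L[ℂ] H)‖ ≤ ρ) :
    ∀ n : ℕ, 1 ≤ n → ∀ F : Matrix (Fin n) (Fin n) (Polynomial ℂ),
      numRadius (matPolyEval T F) ≤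
        (1 / 2) * (ρ + ρ⁻¹) * matPolyNorm (Metric.closedBall (0 : ℂ) 1) F := by
  obtain ⟨S, hC, hS⟩ := h
  intro n _ F
  set M := matPolyNorm (Metric.closedBall (0 : ℂ) 1) F
  set s := ‖(S : H →L[ℂ] H)‖
  set t := ‖((S⁻¹ : (H →L[ℂ] H)ˣ) : H →L[ℂ] H)‖
  have hM (z : ℂ) (hz : ‖z‖ ≤ 1) :
      ‖Matrix.toEuclideanCLM (𝕜 := ℂ) (F.map (eval z))‖ ≤ M :=
    norm_le_matPolyNorm F (isCompact_closedBall 0 1) (by simpa using hz)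
  have hM0 : 0 ≤ M := (norm_nonneg _).trans (hM 0 (by simp))
  refine Real.sSup_le ?_ (by positivity)
  rintro _ ⟨x, hx, rfl⟩
  set C := ((S⁻¹ : (H →L[ℂ] H)ˣ) : H →L[ℂ] H) * T * (S : H →L[ℂ] H)
  set v : Fin n → H := fun i => ((S⁻¹ : (H →L[ℂ] H)ˣ) : H →L[ℂ] H) (x i) with hv
  set y : Fin n → H := fun i => ∑ j, aeval C (F i j) (v j)
  have hSv (i) : (S : H →L[ℂ] H) (v i) = x i := by
    rw [hv, ← mul_apply_eq_comp, Units.mul_inv, one_apply_eq_self]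
  have hx2 : ∑ i, ‖x i‖ ^ 2 = 1 := by
    rw [← PiLp.norm_sq_eq_of_L2, hx, one_pow]
  have hFx (i) : matPolyEval T F x i = (S : H →L[ℂ] H) (y i) := by
    simp [matPolyEval, y, hv, aeval_conj S T, C]
  set α := ∑ i, ‖star (S : H →L[ℂ] H) (x i)‖ ^ 2
  set β := ∑ i, ‖v i‖ ^ 2
  have hα : 0 ≤ α := by positivity
  have hβ : 0 ≤ β := by positivity
  have hy : ∑ i, ‖y i‖ ^ 2 ≤ M ^ 2 * β := sum_norm_sq_aeval_le hC F hM v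
  have hkant : t ^ 2 * α + s ^ 2 * β ≤ (s * t) ^ 2 + 1 := by
    calc t ^ 2 * α + s ^ 2 * β
        = ∑ i, (t ^ 2 * ‖star (S : H →L[ℂ] H) ((S : H →L[ℂ] H) (v i))‖ ^ 2 +
            s ^ 2 * ‖v i‖ ^ 2) := by
          simp only [hSv, Finset.sum_add_distrib, ← Finset.mul_sum, α, β]
      _ ≤ ∑ i, ((s * t) ^ 2 + 1) * ‖(S : H →L[ℂ] H) (v i)‖ ^ 2 :=
          Finset.sum_le_sum fun i _ => kantorovich S (v i)
      _ = (s * t) ^ 2 + 1 := by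
          simp only [hSv, ← Finset.mul_sum, hx2, mul_one]
  have hst : 1 ≤ s * t := by
    have : Nontrivial H := by
      by_contra hH
      rw [not_nontrivial_iff_subsingleton] at hH
      have h0 (i) : x i = 0 := Subsingleton.elim _ _
      simp [h0] at hx2
    calc (1 : ℝ) = ‖(S : H →L[ℂ] H) * ((S⁻¹ : (H →L[ℂ] H)ˣ) : H →L[ℂ] H)‖ := by
          rw [Units.mul_inv, norm_one]
      _ ≤ s * t := norm_mul_le _ _
  have hbound : ‖⟪x, matPolyEval T F x⟫_ℂ‖ ≤ M * (√α * √β) := by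
    calc ‖⟪x, matPolyEval T F x⟫_ℂ‖
        = ‖∑ i, ⟪star (S : H →L[ℂ] H) (x i), y i⟫_ℂ‖ := by
          simp only [PiLp.inner_apply, hFx, star_eq_adjoint, adjoint_inner_left]
      _ ≤ ∑ i, ‖star (S : H →L[ℂ] H) (x i)‖ * ‖y i‖ :=
          (norm_sum_le _ _).trans (Finset.sum_le_sum fun i _ => norm_inner_le_norm _ _)
      _ ≤ √α * √(∑ i, ‖y i‖ ^ 2) := Real.sum_mul_le_sqrt_mul_sqrt _ _ _
      _ ≤ √α * √(M ^ 2 * β) := by gcongr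
      _ = M * (√α * √β) := by
          rw [Real.sqrt_mul (sq_nonneg M), Real.sqrt_sq hM0]; ring
  have hab : √α * √β ≤ 1 / 2 * (s * t + (s * t)⁻¹) := by
    have h1 : 2 * (s * t) * (√α * √β) ≤ (s * t) ^ 2 + 1 := by
      nlinarith [sq_nonneg (t * √α - s * √β), Real.sq_sqrt hα, Real.sq_sqrt hβ]
    have h2 : 1 / 2 * (s * t + (s * t)⁻¹) = ((s * t) ^ 2 + 1) / (2 * (s * t)) := by
      field_simp
    rw [h2, le_div_iff₀ (by positivity)]
    linarith
  have hmono : s * t + (s * t)⁻¹ ≤ ρ + ρ⁻¹ := add_inv_le_add_inv hst hS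
  calc ‖⟪x, matPolyEval T F x⟫_ℂ‖ ≤ M * (√α * √β) := hbound
    _ ≤ M * (1 / 2 * (ρ + ρ⁻¹)) := mul_le_mul_of_nonneg_left (by linarith) hM0
    _ = 1 / 2 * (ρ + ρ⁻¹) * M := by ring

end
end

section
/- Let H be a complex Hilbert space and T a bounded linear operator on H with numerical radius w(T) ≤ 1. Then for every n ≥ 1 and every n×n matrix polynomial F, w(F(T)) ≤ (5/4) · ‖F‖_{D̄}, where D̄ is the closed unit disc in ℂ. -/
open scoped InnerProductSpace
open ContinuousLinearMap Polynomial

noncomputable section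

section DiscreteFourier

variable {M : ℕ} [NeZero M] {E : Type*} [NormedAddCommGroup E] [InnerProductSpace ℂ E]

theorem sum_zmod_val {α : Type*} [AddCommMonoid α] (g : ℕ → α) :
    ∑ j : ZMod M, g j.val = ∑ j ∈ Finset.range M, g j := by
  obtain ⟨m, rfl⟩ := Nat.exists_eq_succ_of_ne_zero (NeZero.ne M)
  exact (Finset.sum_range g).symm

theorem norm_zmod_stdAddChar (t : ZMod M) : ‖(ZMod.stdAddChar t : ℂ)‖ = 1 := by
  rw [ZMod.stdAddChar_apply]; exact Circle.norm_coe _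

theorem sum_inner_zmod_dft (a b : ZMod M → E) :
    ∑ t, ⟪ZMod.dft a t, ZMod.dft b t⟫_ℂ = M * ∑ j, ⟪a j, b j⟫_ℂ := by
  have key (j k : ZMod M) : ∑ t : ZMod M,
      (starRingEnd ℂ) (ZMod.stdAddChar (-(j * t))) * ZMod.stdAddChar (-(k * t)) =
        if j = k then (M : ℂ) else 0 := by
    have h1 (t : ZMod M) : (starRingEnd ℂ) (ZMod.stdAddChar (-(j * t))) *
        ZMod.stdAddChar (-(k * t)) = ZMod.stdAddChar (t * (j - k)) := by
      rw [← AddChar.map_neg_eq_conj, ← AddChar.map_add_eq_mul]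
      congr 1; ring
    simp_rw [h1, AddChar.sum_mulShift _ (ZMod.isPrimitive_stdAddChar M), sub_eq_zero, ZMod.card]
    split_ifs <;> simp
  simp_rw [ZMod.dft_apply, sum_inner, inner_sum, inner_smul_left, inner_smul_right]
  rw [Finset.sum_comm, Finset.mul_sum]
  refine Finset.sum_congr rfl fun j _ => ?_
  rw [Finset.sum_comm]
  simp_rw [← mul_assoc, ← Finset.sum_mul, key]
  simp

theorem sum_norm_sq_zmod_dft (a : ZMod M → E) :
    ∑ t, ‖ZMod.dft a t‖ ^ 2 = M * ∑ j, ‖a j‖ ^ 2 := by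
  have h := sum_inner_zmod_dft a a
  simp_rw [inner_self_eq_norm_sq_to_K] at h
  simp only [RCLike.ofReal_eq_complex_ofReal] at h
  exact_mod_cast h

theorem zmod_dft_shift (a : ZMod M → E) (l t : ZMod M) :
    ZMod.dft (fun j => a (j + l)) t = (ZMod.stdAddChar (l * t) : ℂ) • ZMod.dft a t := by
  simp_rw [ZMod.dft_apply, Finset.smul_sum, smul_smul, ← AddChar.map_add_eq_mul]
  refine Fintype.sum_equiv (Equiv.addRight l) _ _ fun j => ?_
  simp only [Equiv.coe_addRight]
  congr 2; ring

theorem zmod_dft_map {E' : Type*} [AddCommGroup E'] [Module ℂ E'] (S : E →ₗ[ℂ] E')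
    (a : ZMod M → E) (t : ZMod M) : ZMod.dft (fun j => S (a j)) t = S (ZMod.dft a t) := by
  simp [ZMod.dft_apply, map_sum]

/-- The numerical radius does not increase under tensoring with the cyclic shift. -/
theorem norm_sum_inner_shift_le {S : E →L[ℂ] E} {r : ℝ}
    (hS : ∀ y, ‖⟪y, S y⟫_ℂ‖ ≤ r * ‖y‖ ^ 2) (a : ZMod M → E) :
    ‖∑ j, ⟪a (j + 1), S (a j)⟫_ℂ‖ ≤ r * ∑ j, ‖a j‖ ^ 2 := by
  have hM : (0 : ℝ) < M := Nat.cast_pos.2 (Nat.pos_of_neZero M)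
  refine le_of_mul_le_mul_left ?_ hM
  have h := sum_inner_zmod_dft (fun j => a (j + 1)) (fun j => S (a j))
  have e : (M : ℝ) * ‖∑ j, ⟪a (j + 1), S (a j)⟫_ℂ‖ = ‖(M : ℂ) * ∑ j, ⟪a (j + 1), S (a j)⟫_ℂ‖ := by
    simp
  rw [e, ← h]
  calc _ ≤ ∑ t, r * ‖ZMod.dft a t‖ ^ 2 := by
        refine norm_sum_le_of_le _ fun t _ => ?_
        have h2 : ZMod.dft (fun j => S (a j)) t = S (ZMod.dft a t) :=
          zmod_dft_map (S : E →ₗ[ℂ] E) a t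
        rw [zmod_dft_shift, h2, inner_smul_left, norm_mul, RCLike.norm_conj,
          norm_zmod_stdAddChar, one_mul]
        exact hS _
    _ = _ := by rw [← Finset.mul_sum, sum_norm_sq_zmod_dft]; ring

end DiscreteFourier

section Riccati

variable {H : Type*} [NormedAddCommGroup H] [InnerProductSpace ℂ H]

theorem norm_sum_range_inner_succ_le {S : H →L[ℂ] H} {r : ℝ}
    (hS : ∀ y, ‖⟪y, S y⟫_ℂ‖ ≤ r * ‖y‖ ^ 2) {k : ℕ} {f : ℕ → H} (hf : ∀ j, k < j → f j = 0) :
    ‖∑ j ∈ Finset.range (k + 1), ⟪f (j + 1), S (f j)⟫_ℂ‖ ≤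
      r * ∑ j ∈ Finset.range (k + 1), ‖f j‖ ^ 2 := by
  have h := norm_sum_inner_shift_le (M := k + 2) hS (fun j => f j.val)
  have e1 : ∑ j : ZMod (k + 2), ‖f j.val‖ ^ 2 = ∑ j ∈ Finset.range (k + 1), ‖f j‖ ^ 2 := by
    rw [sum_zmod_val fun j => ‖f j‖ ^ 2, Finset.sum_range_succ, hf (k + 1) (by omega)]
    simp
  have e2 : ∑ j : ZMod (k + 2), ⟪f (j + 1).val, S (f j.val)⟫_ℂ =
      ∑ j ∈ Finset.range (k + 1), ⟪f (j + 1), S (f j)⟫_ℂ := by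
    trans ∑ j : ZMod (k + 2), ⟪f (j.val + 1), S (f j.val)⟫_ℂ
    · refine Finset.sum_congr rfl fun j _ => ?_
      rcases lt_or_ge k j.val with hj | hj
      · simp [hf _ hj]
      · rw [ZMod.val_add, ZMod.val_one'' (by omega), Nat.mod_eq_of_lt (by omega)]
    · rw [sum_zmod_val fun j => ⟪f (j + 1), S (f j)⟫_ℂ, Finset.sum_range_succ,
        hf (k + 1) (by omega)]
      simp
  rwa [e1, e2] at h

theorem re_inner_lower {S A : H →L[ℂ] H} {r : ℝ} (hr : r < 1)
    (hS : ∀ y, ‖⟪y, S y⟫_ℂ‖ ≤ r * ‖y‖ ^ 2) {k : ℕ}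
    (hA : ∀ x, ∃ f : ℕ → H, f 0 = x ∧ (∀ j, k < j → f j = 0) ∧ (⟪x, A x⟫_ℂ).re =
      ∑ j ∈ Finset.range (k + 1), (2 * ‖f j‖ ^ 2 + 2 * (⟪f (j + 1), S (f j)⟫_ℂ).re)) (x : H) :
    2 * (1 - r) * ‖x‖ ^ 2 ≤ (⟪x, A x⟫_ℂ).re := by
  obtain ⟨f, rfl, hf, hsum⟩ := hA x
  have h1 := norm_sum_range_inner_succ_le hS hf
  have h2 := (abs_le.1 ((Complex.abs_re_le_norm _).trans h1)).1
  have h3 : ‖f 0‖ ^ 2 ≤ ∑ j ∈ Finset.range (k + 1), ‖f j‖ ^ 2 :=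
    Finset.single_le_sum (f := fun j => ‖f j‖ ^ 2) (fun _ _ => by positivity) (by simp)
  rw [hsum, Finset.sum_add_distrib, ← Finset.mul_sum, ← Finset.mul_sum, ← Complex.re_sum]
  nlinarith

variable [CompleteSpace H]

/-- The iterated Schur complements of the block Toeplitz operator with `2` on the diagonal and
`S`, `S†` next to it. -/
def toeplitzSchur (S : H →L[ℂ] H) : ℕ → (H →L[ℂ] H)
  | 0 => (2 : ℂ) • 1
  | k + 1 => (2 : ℂ) • 1 - adjoint S * Ring.inverse (toeplitzSchur S k) * S

theorem isUnit_of_le_re_inner {A : H →L[ℂ] H} {c : ℝ} (hc : 0 < c)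
    (h : ∀ x, c * ‖x‖ ^ 2 ≤ (⟪x, A x⟫_ℂ).re) : IsUnit A := by
  refine isUnit_of_forall_le_norm_inner_map A (c := ⟨c, hc.le⟩) hc fun x => ?_
  rw [norm_inner_symm, mul_comm]
  exact (h x).trans (Complex.re_le_norm _)

theorem toeplitzSchur_spec {S : H →L[ℂ] H} {r : ℝ} (hr : r < 1)
    (hS : ∀ y, ‖⟪y, S y⟫_ℂ‖ ≤ r * ‖y‖ ^ 2) (k : ℕ) :
    IsSelfAdjoint (toeplitzSchur S k) ∧ IsUnit (toeplitzSchur S k) ∧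
      ∀ x, 0 ≤ (⟪x, toeplitzSchur S k x⟫_ℂ).re := by
  suffices h : IsSelfAdjoint (toeplitzSchur S k) ∧ ∀ x, ∃ f : ℕ → H, f 0 = x ∧
      (∀ j, k < j → f j = 0) ∧ (⟪x, toeplitzSchur S k x⟫_ℂ).re =
        ∑ j ∈ Finset.range (k + 1), (2 * ‖f j‖ ^ 2 + 2 * (⟪f (j + 1), S (f j)⟫_ℂ).re) by
    obtain ⟨hsa, hf⟩ := h
    have hlow := re_inner_lower hr hS hf
    refine ⟨hsa, isUnit_of_le_re_inner (by linarith) hlow, fun x => le_trans ?_ (hlow x)⟩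
    have : 0 < 2 * (1 - r) := by linarith
    positivity
  induction k with
  | zero =>
    refine ⟨?_, fun x => ⟨fun j => if j = 0 then x else 0, by simp, by grind, ?_⟩⟩
    · rw [toeplitzSchur, isSelfAdjoint_iff, star_smul]; simp
    · simp [toeplitzSchur, inner_self_eq_norm_sq_to_K, ← Complex.ofReal_pow]
  | succ k ih =>
    obtain ⟨hsa, hf⟩ := ih
    have hu := isUnit_of_le_re_inner (by linarith) (re_inner_lower hr hS hf)
    set A := toeplitzSchur S k with hA
    refine ⟨?_, fun x => ?_⟩
    · rw [toeplitzSchur, ← star_eq_adjoint, isSelfAdjoint_iff, ← hA]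
      simp [star_mul, mul_assoc, hsa.ringInverse.star_eq]
    · obtain ⟨f, hf0, hfk, hsum⟩ := hf (-(Ring.inverse A (S x)))
      have hAI : A (Ring.inverse A (S x)) = S x := by
        change (A * Ring.inverse A) (S x) = S x
        rw [Ring.mul_inverse_cancel _ hu]; rfl
      refine ⟨fun j => Nat.casesOn j x f, rfl, fun j hj => ?_, ?_⟩
      · cases j with
        | zero => omega
        | succ j => exact hfk j (by omega)
      · rw [Finset.sum_range_succ']
        simp only
        have hx : toeplitzSchur S (k + 1) x =
            (2 : ℂ) • x - adjoint S (Ring.inverse A (S x)) := rfl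
        rw [← hsum, hf0, hx, inner_sub_right, adjoint_inner_right, inner_smul_right,
          inner_self_eq_norm_sq_to_K, map_neg, hAI, inner_neg_neg, inner_neg_left]
        have hc : (⟪S x, Ring.inverse A (S x)⟫_ℂ).re = (⟪Ring.inverse A (S x), S x⟫_ℂ).re :=
          inner_re_symm (𝕜 := ℂ) _ _
        simp [← Complex.ofReal_pow]
        linarith

theorem toeplitzSchur_block_nonneg {S : H →L[ℂ] H} {r : ℝ} (hr : r < 1)
    (hS : ∀ y, ‖⟪y, S y⟫_ℂ‖ ≤ r * ‖y‖ ^ 2) (k : ℕ) (x y : H) :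
    0 ≤ (⟪x, toeplitzSchur S k x⟫_ℂ).re + 2 * (⟪x, S y⟫_ℂ).re + 2 * ‖y‖ ^ 2
      - (⟪y, toeplitzSchur S (k + 1) y⟫_ℂ).re := by
  obtain ⟨hsa, hu, hpos⟩ := toeplitzSchur_spec hr hS k
  set A := toeplitzSchur S k with hA
  have hAI : A (Ring.inverse A (S y)) = S y := by
    change (A * Ring.inverse A) (S y) = S y
    rw [Ring.mul_inverse_cancel _ hu]; rfl
  have hy : toeplitzSchur S (k + 1) y = (2 : ℂ) • y - adjoint S (Ring.inverse A (S y)) := rfl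
  have h := hpos (x + Ring.inverse A (S y))
  have h2 : ⟪Ring.inverse A (S y), A x⟫_ℂ = ⟪S y, x⟫_ℂ := by
    rw [← adjoint_inner_left, ← star_eq_adjoint, hsa.star_eq, hAI]
  have hc (z : H) : (⟪S y, z⟫_ℂ).re = (⟪z, S y⟫_ℂ).re := inner_re_symm (𝕜 := ℂ) _ _
  have hc1 := hc x
  have hc2 := hc (Ring.inverse A (S y))
  rw [map_add, hAI, inner_add_left, inner_add_right, inner_add_right, h2] at h
  rw [hy, inner_sub_right, adjoint_inner_right, inner_smul_right, inner_self_eq_norm_sq_to_K]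
  simp [← Complex.ofReal_pow] at h ⊢
  linarith

/-- Ando's characterization of the numerical radius unit ball, for strict contractions with respect
to the numerical radius. -/
theorem exists_ando {T : H →L[ℂ] H} (hT : ∀ y, ‖⟪y, T y⟫_ℂ‖ ≤ ‖y‖ ^ 2) {s : ℝ} (hs0 : 0 ≤ s)
    (hs : s < 1) : ∃ A : H →L[ℂ] H, IsSelfAdjoint A ∧ ∀ x y,
      0 ≤ (⟪x, A x⟫_ℂ).re + 2 * (⟪x, ((s : ℂ) • T) y⟫_ℂ).re + 2 * ‖y‖ ^ 2 - (⟪y, A y⟫_ℂ).re := by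
  obtain ⟨N, hN⟩ := exists_nat_gt (s / (1 - s))
  have hN0 : (0 : ℝ) < N := lt_of_le_of_lt (div_nonneg hs0 (by linarith)) hN
  have hr : s * (N + 1) / N < 1 := by
    rw [div_lt_iff₀ (by linarith)] at hN
    rw [div_lt_one hN0]; linarith
  set r := s * (N + 1) / N with hrdef
  have hr0 : 0 ≤ r := by positivity
  have hS : ∀ y, ‖⟪y, ((r : ℂ) • T) y⟫_ℂ‖ ≤ r * ‖y‖ ^ 2 := fun y => by
    rw [smul_apply, inner_smul_right, norm_mul, Complex.norm_real, Real.norm_of_nonneg hr0]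
    exact mul_le_mul_of_nonneg_left (hT y) hr0
  set S := (r : ℂ) • T with hSdef
  refine ⟨((N + 1 : ℝ)⁻¹ : ℂ) • ∑ k ∈ Finset.range N, toeplitzSchur S k, ?_, fun x y => ?_⟩
  · rw [isSelfAdjoint_iff, star_smul, star_sum]
    simp [fun k => (toeplitzSchur_spec hr hS k).1.star_eq]
  · have h := Finset.sum_nonneg fun k (_ : k ∈ Finset.range N) =>
      toeplitzSchur_block_nonneg hr hS k x y
    have htel := Finset.sum_range_sub (fun k => (⟪y, toeplitzSchur S k y⟫_ℂ).re) N
    have hlast := (toeplitzSchur_spec hr hS N).2.2 y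
    have hzero : (⟪y, toeplitzSchur S 0 y⟫_ℂ).re = 2 * ‖y‖ ^ 2 := by
      simp [toeplitzSchur, inner_self_eq_norm_sq_to_K, ← Complex.ofReal_pow]
    have hN1 : (0 : ℝ) < N + 1 := by linarith
    have hA (z : H) : (⟪z, (((N + 1 : ℝ)⁻¹ : ℂ) • ∑ k ∈ Finset.range N, toeplitzSchur S k) z⟫_ℂ).re =
        (N + 1 : ℝ)⁻¹ * ∑ k ∈ Finset.range N, (⟪z, toeplitzSchur S k z⟫_ℂ).re := by
      rw [smul_apply, sum_apply, inner_smul_right, inner_sum, ← Complex.re_sum]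
      rw [← Complex.re_ofReal_mul]
      simp
    have hsT : (⟪x, ((s : ℂ) • T) y⟫_ℂ).re = (N + 1 : ℝ)⁻¹ * (N * (⟪x, S y⟫_ℂ).re) := by
      rw [hSdef, smul_apply, smul_apply, inner_smul_right, inner_smul_right,
        Complex.re_ofReal_mul, Complex.re_ofReal_mul, hrdef]
      field_simp
    have hy : 2 * ‖y‖ ^ 2 = (N + 1 : ℝ)⁻¹ * ((N + 1) * (2 * ‖y‖ ^ 2)) := by
      field_simp
    rw [hA, hA, hsT, hy, mul_left_comm, ← mul_add, ← mul_add, ← mul_sub]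
    refine mul_nonneg (by positivity) ?_
    simp only [Finset.sum_add_distrib, Finset.sum_sub_distrib, Finset.sum_const, Finset.card_range,
      nsmul_eq_mul] at h htel
    linarith

end Riccati

section Similarity

variable {H : Type*} [NormedAddCommGroup H] [InnerProductSpace ℂ H] 

theorem re_inner_le_of_le {A B : H →L[ℂ] H} (h : A ≤ B) (x : H) :
    (⟪x, A x⟫_ℂ).re ≤ (⟪x, B x⟫_ℂ).re := by
  have := ((ContinuousLinearMap.le_def A B).1 h).re_inner_nonneg_right x
  rw [sub_apply, inner_sub_right, map_sub] at this
  exact sub_nonneg.1 this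

variable [CompleteSpace H]

theorem le_of_re_inner_le {A B : H →L[ℂ] H} (hA : IsSelfAdjoint A) (hB : IsSelfAdjoint B)
    (h : ∀ x, (⟪x, A x⟫_ℂ).re ≤ (⟪x, B x⟫_ℂ).re) : A ≤ B := by
  rw [ContinuousLinearMap.le_def, isPositive_def']
  refine ⟨hB.sub hA, fun x => ?_⟩
  rw [reApplyInnerSelf_apply, inner_re_symm, sub_apply, inner_sub_right, map_sub]
  exact sub_nonneg.2 (h x)

theorem exists_continuous_weights : ∃ e g : ℝ → ℝ, Continuous e ∧ Continuous g ∧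
    (∀ a, g a * e a = 1) ∧
    (∀ a, 0 ≤ a → a ≤ 2 → e a * e a + g a * g a ≤ 5 / 2) ∧
    (∀ a, 0 ≤ a → a ≤ 2 → e a * e a * a * (e a * e a) ≤ e a * e a) ∧
    ∀ a, 0 ≤ a → a ≤ 2 → 2 - a ≤ e a * e a := by
  have hpos (a : ℝ) : 0 < max (1 / 2) a := lt_of_lt_of_le (by norm_num) (le_max_left _ _)
  have hg : Continuous fun a : ℝ => √(max (1 / 2) a) := by fun_prop
  have hgpos (a : ℝ) : 0 < √(max (1 / 2) a) := Real.sqrt_pos.2 (hpos a)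
  have hee (a : ℝ) : (√(max (1 / 2) a))⁻¹ * (√(max (1 / 2) a))⁻¹ = (max (1 / 2) a)⁻¹ := by
    rw [← mul_inv, Real.mul_self_sqrt (hpos a).le]
  refine ⟨fun a => (√(max (1 / 2) a))⁻¹, fun a => √(max (1 / 2) a),
    hg.inv₀ fun a => (hgpos a).ne', hg, fun a => mul_inv_cancel₀ (hgpos a).ne',
    fun a _ ha => ?_, fun a _ _ => ?_, fun a h0 ha => ?_⟩
  · simp only [hee, Real.mul_self_sqrt (hpos a).le]
    have h1 : 1 / 2 ≤ max (1 / 2) a := le_max_left _ _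
    have h2 : max (1 / 2) a ≤ 2 := max_le (by norm_num) ha
    have h3 := hpos a
    generalize max (1 / 2) a = h at *
    rw [← sub_nonneg]
    have : 5 / 2 - (h⁻¹ + h) = (h - 1 / 2) * (2 - h) / h := by field_simp; ring
    rw [this]
    exact div_nonneg (mul_nonneg (by linarith) (by linarith)) h3.le
  · simp only [hee]
    have : (max (1 / 2) a)⁻¹ * a ≤ 1 := by
      rw [inv_mul_le_one₀ (hpos a)]; exact le_max_right _ _
    exact mul_le_of_le_one_left (inv_nonneg.2 (hpos a).le) this
  · simp only [hee]
    rw [← one_div, le_div_iff₀ (hpos a)]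
    rcases max_cases (1 / 2) a with h | h <;> rw [h.1] <;> nlinarith [sq_nonneg (a - 1)]

/-- An operator in the form of Ando's theorem is similar to a contraction, by means of a
selfadjoint `E` with inverse `G` such that `E² + G² ≤ 5 / 2`. -/
theorem exists_similarity {S A : H →L[ℂ] H} (hA : IsSelfAdjoint A)
    (hS : ∀ x y, 0 ≤ (⟪x, A x⟫_ℂ).re + 2 * (⟪x, S y⟫_ℂ).re + 2 * ‖y‖ ^ 2 - (⟪y, A y⟫_ℂ).re) :
    ∃ E G : H →L[ℂ] H, IsSelfAdjoint G ∧ G * E = 1 ∧ E * G = 1 ∧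
      (∀ x, ‖E x‖ ^ 2 + ‖G x‖ ^ 2 ≤ 5 / 2 * ‖x‖ ^ 2) ∧ ∀ y, ‖E (S y)‖ ≤ ‖E y‖ := by
  have hscalar (c : ℝ) (x : H) : (⟪x, algebraMap ℝ (H →L[ℂ] H) c x⟫_ℂ).re = c * ‖x‖ ^ 2 := by
    rw [Algebra.algebraMap_eq_smul_one, smul_apply]
    simp [inner_self_eq_norm_sq_to_K, ← Complex.ofReal_pow]
  have hA0 : 0 ≤ A := le_of_re_inner_le (.zero _) hA fun x => by simpa using hS x 0
  have hA2 : A ≤ algebraMap ℝ _ 2 := le_of_re_inner_le hA (.algebraMap _ (.all _)) fun y => by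
    have := hS 0 y
    rw [hscalar]
    simp at this
    linarith
  have hspec : ∀ a ∈ spectrum ℝ A, 0 ≤ a ∧ a ≤ 2 := fun a ha =>
    ⟨spectrum_nonneg_of_nonneg hA0 ha, (le_algebraMap_iff_spectrum_le hA).1 hA2 a ha⟩
  obtain ⟨e, g, he, hg, hge, hbd, hmul, hlow⟩ := exists_continuous_weights
  have hc2 {f f' : ℝ → ℝ} (hf : Continuous f) (hf' : Continuous f') :
      cfc f A * cfc f' A = cfc (fun a => f a * f' a) A :=
    (cfc_mul f f' A hf.continuousOn hf'.continuousOn).symm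
  have hEsa : IsSelfAdjoint (cfc e A) := cfc_predicate _ _
  have hGsa : IsSelfAdjoint (cfc g A) := cfc_predicate _ _
  have hGE : cfc g A * cfc e A = 1 := by
    rw [hc2 hg he, ← cfc_one ℝ A]
    exact cfc_congr fun a _ => hge a
  have hEG : cfc e A * cfc g A = 1 := by
    rw [hc2 he hg, ← cfc_one ℝ A]
    exact cfc_congr fun a _ => (mul_comm _ _).trans (hge a)
  have hee : Continuous fun a => e a * e a := he.mul he
  have hgg : Continuous fun a => g a * g a := hg.mul hg
  have hsq {D : H →L[ℂ] H} (hD : IsSelfAdjoint D) (x : H) :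
      ‖D x‖ ^ 2 = (⟪x, (D * D) x⟫_ℂ).re := by
    change _ = (⟪x, D (D x)⟫_ℂ).re
    rw [← adjoint_inner_left, ← star_eq_adjoint, hD.star_eq, inner_self_eq_norm_sq_to_K]
    simp [← Complex.ofReal_pow]
  refine ⟨cfc e A, cfc g A, hGsa, hGE, hEG, fun x => ?_, fun y => ?_⟩
  · rw [hsq hEsa, hsq hGsa, ← Complex.add_re, ← inner_add_right, ← add_apply, ← hscalar]
    refine re_inner_le_of_le ?_ x
    rw [hc2 he he, hc2 hg hg, ← cfc_add A _ _ hee.continuousOn hgg.continuousOn]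
    exact cfc_le_algebraMap _ _ _ (fun a ha => hbd a (hspec a ha).1 (hspec a ha).2)
      (hee.add hgg).continuousOn hA
  · refine le_of_sq_le_sq ?_ (norm_nonneg _)
    rw [hsq hEsa, hsq hEsa, hc2 he he]
    set B := cfc (fun a => e a * e a) A with hB
    have hBsa : IsSelfAdjoint B := cfc_predicate _ _
    have hid : cfc (fun a : ℝ => a) A = A := cfc_id' ℝ A hA
    have h1 : B * A * B ≤ B := by
      have : B * A * B = cfc (fun a => e a * e a * a * (e a * e a)) A := by
        rw [← hc2 (f := fun a => e a * e a * a) (hee.mul continuous_id') hee,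
          ← hc2 (f' := fun a => a) hee continuous_id', hid]
      rw [this, hB]
      exact cfc_mono (fun a ha => hmul a (hspec a ha).1 (hspec a ha).2)
        ((hee.mul continuous_id').mul hee).continuousOn hee.continuousOn
    have h2 : algebraMap ℝ _ 2 - A ≤ B := by
      have : algebraMap ℝ _ 2 - A = cfc (fun a : ℝ => 2 - a) A := by
        rw [cfc_sub (fun _ : ℝ => (2 : ℝ)) (fun a => a) A continuousOn_const
          (continuousOn_id' _),
          hid, cfc_const 2 A hA]
      rw [this, hB]
      exact cfc_mono (fun a ha => hlow a (hspec a ha).1 (hspec a ha).2)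
        (continuous_const.sub continuous_id').continuousOn hee.continuousOn
    have h3 := re_inner_le_of_le h1 (S y)
    have h4 := re_inner_le_of_le h2 y
    have h5 := hS (-B (S y)) y
    have h6 : (B * A * B) (S y) = B (A (B (S y))) := rfl
    rw [sub_apply, inner_sub_right, Complex.sub_re, hscalar] at h4
    rw [h6, ← adjoint_inner_left, ← star_eq_adjoint, hBsa.star_eq] at h3
    rw [map_neg, inner_neg_neg, inner_neg_left, Complex.neg_re] at h5
    have h7 : (⟪B (S y), S y⟫_ℂ).re = (⟪S y, B (S y)⟫_ℂ).re := inner_re_symm (𝕜 := ℂ) _ _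
    linarith

end Similarity

section VonNeumann

theorem sum_norm_sq_matrix_smul_le {n : ℕ} {E : Type*} [NormedAddCommGroup E]
    [InnerProductSpace ℂ E] {A : Matrix (Fin n) (Fin n) ℂ} {c : ℝ}
    (hA : ‖Matrix.toEuclideanCLM (𝕜 := ℂ) A‖ ≤ c) (v : Fin n → E) :
    ∑ i, ‖∑ j, A i j • v j‖ ^ 2 ≤ c ^ 2 * ∑ j, ‖v j‖ ^ 2 := by
  set V := Submodule.span ℂ (Set.range v) with hV
  have : FiniteDimensional ℂ V := FiniteDimensional.span_of_finite ℂ (Set.finite_range v)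
  let v' : Fin n → V := fun j => ⟨v j, Submodule.subset_span ⟨j, rfl⟩⟩
  let b := stdOrthonormalBasis ℂ V
  have h1 (j : Fin n) : ‖v j‖ ^ 2 = ∑ e, ‖⟪b e, v' j⟫_ℂ‖ ^ 2 :=
    (b.sum_sq_norm_inner_right (v' j)).symm
  have h2 (i : Fin n) : ‖∑ j, A i j • v j‖ ^ 2 = ∑ e, ‖∑ j, A i j * ⟪b e, v' j⟫_ℂ‖ ^ 2 := by
    have h : ‖∑ j, A i j • v j‖ = ‖∑ j, A i j • v' j‖ := by
      have h' : ((∑ j, A i j • v' j : V) : E) = ∑ j, A i j • v j := by simp [v']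
      rw [← h']
      rfl
    rw [h, ← b.sum_sq_norm_inner_right]
    simp_rw [inner_sum, inner_smul_right]
  simp_rw [h1, h2]
  rw [Finset.sum_comm, Finset.sum_comm (f := fun j e => ‖⟪b e, v' j⟫_ℂ‖ ^ 2), Finset.mul_sum]
  refine Finset.sum_le_sum fun e _ => ?_
  have h3 := (Matrix.toEuclideanCLM (𝕜 := ℂ) A).le_of_opNorm_le hA
    (WithLp.toLp 2 fun j => ⟪b e, v' j⟫_ℂ)
  have h4 := pow_le_pow_left₀ (norm_nonneg _) h3 2
  rw [mul_pow, EuclideanSpace.norm_sq_eq, EuclideanSpace.norm_sq_eq] at h4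
  exact h4

theorem sum_norm_sq_cyclic_le {n d M : ℕ} [NeZero M] {E : Type*} [NormedAddCommGroup E]
    [InnerProductSpace ℂ E] {F : Matrix (Fin n) (Fin n) (Polynomial ℂ)} {c : ℝ}
    (hd : ∀ i j, (F i j).natDegree < d)
    (hF : ∀ z : ℂ, ‖z‖ = 1 → ‖Matrix.toEuclideanCLM (𝕜 := ℂ) (F.map (Polynomial.eval z))‖ ≤ c)
    (a : Fin n → ZMod M → E) :
    ∑ i, ∑ k, ‖∑ j, ∑ l ∈ Finset.range d, (F i j).coeff l • a j (k + (l : ZMod M))‖ ^ 2 ≤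
      c ^ 2 * ∑ j, ∑ k, ‖a j k‖ ^ 2 := by
  have hM : (0 : ℝ) < M := Nat.cast_pos.2 (Nat.pos_of_neZero M)
  refine le_of_mul_le_mul_left ?_ hM
  have hdft (i : Fin n) (t : ZMod M) :
      ZMod.dft (fun k => ∑ j, ∑ l ∈ Finset.range d, (F i j).coeff l • a j (k + (l : ZMod M))) t =
        ∑ j, (F.map (Polynomial.eval (ZMod.stdAddChar t : ℂ))) i j • ZMod.dft (a j) t := by
    have e1 : (fun k => ∑ j, ∑ l ∈ Finset.range d, (F i j).coeff l • a j (k + (l : ZMod M))) =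
        ∑ j, ∑ l ∈ Finset.range d, (F i j).coeff l • fun k => a j (k + (l : ZMod M)) := by
      ext k; simp [Finset.sum_apply]
    rw [e1]
    simp only [map_sum, map_smul, Finset.sum_apply, Pi.smul_apply, zmod_dft_shift, Matrix.map_apply]
    refine Finset.sum_congr rfl fun j _ => ?_
    rw [Polynomial.eval_eq_sum_range' (hd i j), Finset.sum_smul]
    refine Finset.sum_congr rfl fun l _ => ?_
    rw [smul_smul, ← nsmul_eq_mul, AddChar.map_nsmul_eq_pow]
  have e2 : (M : ℝ) * (c ^ 2 * ∑ j, ∑ k, ‖a j k‖ ^ 2) =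
      c ^ 2 * ∑ j, (M : ℝ) * ∑ k, ‖a j k‖ ^ 2 := by
    rw [← Finset.mul_sum]; ring
  rw [e2, Finset.mul_sum]
  simp_rw [← sum_norm_sq_zmod_dft, hdft]
  rw [Finset.sum_comm, Finset.sum_comm (f := fun j t => ‖ZMod.dft (a j) t‖ ^ 2), Finset.mul_sum]
  exact Finset.sum_le_sum fun t _ =>
    sum_norm_sq_matrix_smul_le (hF _ (norm_zmod_stdAddChar t)) _

variable {H : Type*} [NormedAddCommGroup H] [InnerProductSpace ℂ H] [CompleteSpace H]

theorem exists_defect {Y : H →L[ℂ] H} (hY : ‖Y‖ ≤ 1) :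
    ∃ D : H →L[ℂ] H, ∀ x, ‖D x‖ ^ 2 = ‖x‖ ^ 2 - ‖Y x‖ ^ 2 := by
  have hx (x : H) : (⟪x, (1 : H →L[ℂ] H) x⟫_ℂ).re = ‖x‖ ^ 2 := by
    simp [inner_self_eq_norm_sq_to_K, ← Complex.ofReal_pow]
  have hsq (Z : H →L[ℂ] H) (x : H) : (⟪x, (star Z * Z) x⟫_ℂ).re = ‖Z x‖ ^ 2 := by
    change (⟪x, adjoint Z (Z x)⟫_ℂ).re = _
    rw [adjoint_inner_right, inner_self_eq_norm_sq_to_K]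
    simp [← Complex.ofReal_pow]
  have hle : star Y * Y ≤ 1 := le_of_re_inner_le (.star_mul_self Y) (.one _) fun x => by
    rw [hsq, hx]
    exact pow_le_pow_left₀ (norm_nonneg _)
      ((Y.le_of_opNorm_le hY x).trans_eq (one_mul _)) 2
  obtain ⟨D, hD⟩ := CStarAlgebra.nonneg_iff_eq_star_mul_self.1 (sub_nonneg.2 hle)
  refine ⟨D, fun x => ?_⟩
  rw [← hsq, ← hD, sub_apply, inner_sub_right, Complex.sub_re, hsq, hx]

/-- Von Neumann's inequality for matrix polynomials in a strict contraction. -/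
theorem sum_norm_sq_aeval_le {n : ℕ} {Y : H →L[ℂ] H} (hY : ‖Y‖ < 1)
    {F : Matrix (Fin n) (Fin n) (Polynomial ℂ)} {c : ℝ}
    (hF : ∀ z : ℂ, ‖z‖ = 1 → ‖Matrix.toEuclideanCLM (𝕜 := ℂ) (F.map (Polynomial.eval z))‖ ≤ c)
    (x : Fin n → H) :
    ∑ i, ‖∑ j, aeval Y (F i j) (x j)‖ ^ 2 ≤ c ^ 2 * ∑ j, ‖x j‖ ^ 2 := by
  obtain ⟨D, hD⟩ := exists_defect hY.le
  have htel (N : ℕ) (z : H) :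
      ∑ k ∈ Finset.range N, ‖D ((Y ^ k) z)‖ ^ 2 = ‖z‖ ^ 2 - ‖(Y ^ N) z‖ ^ 2 := by
    have h := Finset.sum_range_sub' (fun k => ‖(Y ^ k) z‖ ^ 2) N
    rw [pow_zero] at h
    refine Eq.trans (Finset.sum_congr rfl fun k _ => ?_) h
    have hk : (Y ^ (k + 1)) z = Y ((Y ^ k) z) := by rw [pow_succ']; rfl
    rw [hD, hk]
  obtain ⟨d, hd⟩ : ∃ d, ∀ i j, (F i j).natDegree < d :=
    ⟨(∑ i, ∑ j, (F i j).natDegree) + 1, fun i j => Nat.lt_succ_of_le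
      ((Finset.single_le_sum (f := fun j => (F i j).natDegree) (fun _ _ => Nat.zero_le _)
        (Finset.mem_univ j)).trans
      (Finset.single_le_sum (f := fun i => ∑ j, (F i j).natDegree) (fun _ _ => Nat.zero_le _)
        (Finset.mem_univ i)))⟩
  set w : Fin n → H := fun i => ∑ j, aeval Y (F i j) (x j) with hw
  have hN (N : ℕ) : ∑ i, (‖w i‖ ^ 2 - ‖(Y ^ (N + 1)) (w i)‖ ^ 2) ≤ c ^ 2 * ∑ j, ‖x j‖ ^ 2 := by
    have h := sum_norm_sq_cyclic_le (M := N + 1 + d) (E := H) hd hF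
      (fun j k => D ((Y ^ k.val) (x j)))
    refine le_trans (Finset.sum_le_sum fun i _ => ?_) (h.trans ?_)
    · have hext : ∑ k ∈ Finset.range (N + 1), ‖D ((Y ^ k) (w i))‖ ^ 2 =
          ∑ k : ZMod (N + 1 + d), if k.val < N + 1 then ‖D ((Y ^ k.val) (w i))‖ ^ 2 else 0 := by
        rw [sum_zmod_val fun k => if k < N + 1 then ‖D ((Y ^ k) (w i))‖ ^ 2 else 0,
          ← Finset.sum_subset (Finset.range_mono (Nat.le_add_right (N + 1) d))
            fun k _ hk => if_neg fun h => hk (Finset.mem_range.2 h)]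
        exact Finset.sum_congr rfl fun k hk => (if_pos (Finset.mem_range.1 hk)).symm
      rw [← htel, hext]
      refine Finset.sum_le_sum fun k _ => ?_
      split_ifs with hk
      · refine le_of_eq ?_
        congr 2
        have hval (l : ℕ) (hl : l < d) : (k + (l : ZMod (N + 1 + d))).val = k.val + l := by
          rw [ZMod.val_add, ZMod.val_natCast, Nat.mod_eq_of_lt (a := l) (by omega),
            Nat.mod_eq_of_lt (by omega)]
        simp only [hw, map_sum]
        refine Finset.sum_congr rfl fun j _ => ?_
        rw [Polynomial.aeval_eq_sum_range' (hd i j), _root_.sum_apply, map_sum, map_sum]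
        refine Finset.sum_congr rfl fun l hl => ?_
        rw [hval l (Finset.mem_range.1 hl), pow_add, smul_apply, map_smul, map_smul]
        rfl
      · positivity
    · refine mul_le_mul_of_nonneg_left (Finset.sum_le_sum fun j _ => ?_) (sq_nonneg c)
      rw [sum_zmod_val fun k => ‖D ((Y ^ k) (x j))‖ ^ 2, htel]
      linarith [sq_nonneg ‖(Y ^ (N + 1 + d)) (x j)‖]
  have hlim : Filter.Tendsto (fun N : ℕ => ∑ i, (‖w i‖ ^ 2 - ‖(Y ^ (N + 1)) (w i)‖ ^ 2))
      Filter.atTop (nhds (∑ i, (‖w i‖ ^ 2 - ‖(0 : H →L[ℂ] H) (w i)‖ ^ 2))) := by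
    have h0 : Filter.Tendsto (fun N : ℕ => Y ^ (N + 1)) Filter.atTop (nhds 0) :=
      (tendsto_pow_atTop_nhds_zero_of_norm_lt_one hY).comp (Filter.tendsto_add_atTop_nat 1)
    have h1 (i : Fin n) : Filter.Tendsto (fun N : ℕ => (Y ^ (N + 1)) (w i)) Filter.atTop
        (nhds ((0 : H →L[ℂ] H) (w i))) :=
      ((ContinuousLinearMap.apply ℂ H (w i)).continuous.tendsto _).comp h0
    exact tendsto_finsetSum _ fun i _ => tendsto_const_nhds.sub ((h1 i).norm.pow 2)
  have := le_of_tendsto' hlim hN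
  simpa using this

end VonNeumann

section NumericalRadius

theorem aeval_intertwine {H : Type*} [NormedAddCommGroup H] [InnerProductSpace ℂ H]
    {E S Y : H →L[ℂ] H} (h : E * S = Y * E) (p : Polynomial ℂ) :
    E * aeval S p = aeval Y p * E := by
  induction p using Polynomial.induction_on' with
  | add p q hp hq => rw [map_add, map_add, mul_add, add_mul, hp, hq]
  | monomial m a =>
    have hpow : E * S ^ m = Y ^ m * E := (SemiconjBy.pow_right (a := E) (x := S) (y := Y) h m)
    rw [aeval_monomial, aeval_monomial, Algebra.algebraMap_eq_smul_one, smul_one_mul,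
      smul_one_mul, mul_smul_comm, smul_mul_assoc, hpow]

theorem inner_matPolyEval {H : Type*} [NormedAddCommGroup H] [InnerProductSpace ℂ H] {n : ℕ}
    (T : H →L[ℂ] H) (F : Matrix (Fin n) (Fin n) (Polynomial ℂ)) (x : PiLp 2 fun _ : Fin n => H) :
    ⟪x, matPolyEval T F x⟫_ℂ = ∑ i, ⟪x i, ∑ j, aeval T (F i j) (x j)⟫_ℂ := by
  rw [PiLp.inner_apply]
  refine Finset.sum_congr rfl fun i _ => ?_
  simp [matPolyEval, inner_sum]

theorem norm_toEuclideanCLM_eval_le_matPolyNorm {n : ℕ}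
    (F : Matrix (Fin n) (Fin n) (Polynomial ℂ)) {z : ℂ} (hz : z ∈ Metric.closedBall (0 : ℂ) 1) :
    ‖Matrix.toEuclideanCLM (𝕜 := ℂ) (F.map (Polynomial.eval z))‖ ≤
      matPolyNorm (Metric.closedBall (0 : ℂ) 1) F := by
  have hcont : Continuous fun z : ℂ =>
      ‖Matrix.toEuclideanCLM (n := Fin n) (𝕜 := ℂ) (F.map (Polynomial.eval z))‖ := by
    have h1 : Continuous fun z : ℂ => F.map (Polynomial.eval z) :=
      continuous_matrix fun i j => (F i j).continuous
    have h2 : Continuous fun A : Matrix (Fin n) (Fin n) ℂ =>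
        Matrix.toEuclideanCLM (n := Fin n) (𝕜 := ℂ) A :=
      (Matrix.toEuclideanCLM (n := Fin n) (𝕜 := ℂ)).toAlgEquiv.toLinearMap
        |>.continuous_of_finiteDimensional
    exact (h2.comp h1).norm
  have hbdd := (isCompact_closedBall (0 : ℂ) 1).bddAbove_image hcont.continuousOn
  refine le_csSup (hbdd.mono ?_) ⟨z, hz, rfl⟩
  rintro _ ⟨z, hz, rfl⟩
  exact ⟨z, hz, rfl⟩

theorem norm_inner_le_of_numRadius_le_one {H : Type*} [NormedAddCommGroup H]
    [InnerProductSpace ℂ H] {T : H →L[ℂ] H} (hT : numRadius T ≤ 1) (y : H) :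
    ‖⟪y, T y⟫_ℂ‖ ≤ ‖y‖ ^ 2 := by
  rcases eq_or_ne y 0 with rfl | hy
  · simp
  have hy' : (0 : ℝ) < ‖y‖ := norm_pos_iff.2 hy
  have hb : BddAbove {r : ℝ | ∃ x : H, ‖x‖ = 1 ∧ r = ‖(⟪x, T x⟫_ℂ : ℂ)‖} := by
    refine ⟨‖T‖, ?_⟩
    rintro _ ⟨x, hx, rfl⟩
    refine (norm_inner_le_norm _ _).trans ?_
    simpa [hx] using T.le_opNorm x
  have h := (le_csSup hb ⟨((‖y‖⁻¹ : ℝ) : ℂ) • y, by simp [norm_smul, hy'.ne'], rfl⟩).trans hT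
  rw [map_smul, inner_smul_left, inner_smul_right, norm_mul, norm_mul] at h
  simp only [Complex.conj_ofReal, Complex.norm_real, norm_inv, norm_norm] at h
  field_simp at h
  exact h

variable {H : Type*} [NormedAddCommGroup H] [InnerProductSpace ℂ H] [CompleteSpace H]

theorem norm_inner_matPolyEval_smul_le {T : H →L[ℂ] H} (hT : ∀ y, ‖⟪y, T y⟫_ℂ‖ ≤ ‖y‖ ^ 2)
    {r : ℝ} (hr0 : 0 ≤ r) (hr1 : r < 1) {n : ℕ} {F : Matrix (Fin n) (Fin n) (Polynomial ℂ)}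
    {c : ℝ} (hc : 0 ≤ c)
    (hF : ∀ z : ℂ, ‖z‖ = 1 → ‖Matrix.toEuclideanCLM (𝕜 := ℂ) (F.map (Polynomial.eval z))‖ ≤ c)
    (x : PiLp 2 fun _ : Fin n => H) :
    ‖⟪x, matPolyEval (((r ^ 2 : ℝ) : ℂ) • T) F x⟫_ℂ‖ ≤ 5 / 4 * c * ‖x‖ ^ 2 := by
  obtain ⟨A, hA, hAT⟩ := exists_ando hT hr0 hr1
  obtain ⟨E, G, hG, hGE, hEG, hbd, hES⟩ := exists_similarity hA hAT
  have hGE' (v : H) : G (E v) = v := DFunLike.congr_fun hGE v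
  have hEG' (v : H) : E (G v) = v := DFunLike.congr_fun hEG v
  set Y : H →L[ℂ] H := (r : ℂ) • (E * ((r : ℂ) • T) * G) with hYdef
  have hY : ‖Y‖ < 1 := by
    refine lt_of_le_of_lt (Y.opNorm_le_bound hr0 fun v => ?_) hr1
    have h : ‖E (((r : ℂ) • T) (G v))‖ ≤ ‖v‖ := (hES (G v)).trans_eq (by rw [hEG'])
    calc ‖Y v‖ = r * ‖E (((r : ℂ) • T) (G v))‖ := by
          rw [hYdef, smul_apply, norm_smul, Complex.norm_real, Real.norm_of_nonneg hr0]; rfl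
      _ ≤ r * ‖v‖ := mul_le_mul_of_nonneg_left h hr0
  have hint : E * (((r ^ 2 : ℝ) : ℂ) • T) = Y * E := by
    rw [hYdef, smul_mul_assoc, mul_assoc, hGE, mul_one, mul_smul_comm, mul_smul_comm, smul_smul]
    congr 1
    push_cast
    ring
  have haeval (p : Polynomial ℂ) (v : H) :
      aeval (((r ^ 2 : ℝ) : ℂ) • T) p v = G (aeval Y p (E v)) := by
    rw [← hGE' ((aeval (((r ^ 2 : ℝ) : ℂ) • T) p : H →L[ℂ] H) v)]
    exact congrArg G (DFunLike.congr_fun (aeval_intertwine hint p) v)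
  set w : Fin n → H := fun i => ∑ j, aeval Y (F i j) (E (x j)) with hw
  have hsum : ⟪x, matPolyEval (((r ^ 2 : ℝ) : ℂ) • T) F x⟫_ℂ = ∑ i, ⟪G (x i), w i⟫_ℂ := by
    rw [inner_matPolyEval]
    refine Finset.sum_congr rfl fun i _ => ?_
    simp_rw [haeval, ← map_sum]
    rw [← adjoint_inner_left, ← star_eq_adjoint, hG.star_eq]
  have hvN : ∑ i, ‖w i‖ ^ 2 ≤ c ^ 2 * ∑ j, ‖E (x j)‖ ^ 2 :=
    sum_norm_sq_aeval_le hY hF fun j => E (x j)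
  have hx : ∑ i, ‖E (x i)‖ ^ 2 + ∑ i, ‖G (x i)‖ ^ 2 ≤ 5 / 2 * ‖x‖ ^ 2 := by
    rw [← Finset.sum_add_distrib, PiLp.norm_sq_eq_of_L2, Finset.mul_sum]
    exact Finset.sum_le_sum fun i _ => hbd (x i)
  have hCS : ‖∑ i, ⟪G (x i), w i⟫_ℂ‖ ^ 2 ≤ (∑ i, ‖G (x i)‖ ^ 2) * ∑ i, ‖w i‖ ^ 2 := by
    refine le_trans (pow_le_pow_left₀ (norm_nonneg _) ((norm_sum_le _ _).trans
      (Finset.sum_le_sum fun i _ => norm_inner_le_norm _ _)) 2) ?_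
    exact Finset.sum_mul_sq_le_sq_mul_sq _ _ _
  rw [hsum]
  set a := ∑ i, ‖E (x i)‖ ^ 2
  set b := ∑ i, ‖G (x i)‖ ^ 2
  have ha : 0 ≤ a := Finset.sum_nonneg fun _ _ => sq_nonneg _
  have hb : 0 ≤ b := Finset.sum_nonneg fun _ _ => sq_nonneg _
  have hmid : ‖∑ i, ⟪G (x i), w i⟫_ℂ‖ ≤ c * ((a + b) / 2) := by
    refine le_of_sq_le_sq ?_ (by positivity)
    refine hCS.trans ((mul_le_mul_of_nonneg_left hvN hb).trans ?_)
    nlinarith [mul_nonneg (sq_nonneg c) (sq_nonneg (a - b))]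
  refine hmid.trans ?_
  nlinarith [mul_le_mul_of_nonneg_left hx hc]

theorem norm_inner_matPolyEval_le {T : H →L[ℂ] H} (hT : ∀ y, ‖⟪y, T y⟫_ℂ‖ ≤ ‖y‖ ^ 2)
    {n : ℕ} {F : Matrix (Fin n) (Fin n) (Polynomial ℂ)} {c : ℝ} (hc : 0 ≤ c)
    (hF : ∀ z : ℂ, ‖z‖ = 1 → ‖Matrix.toEuclideanCLM (𝕜 := ℂ) (F.map (Polynomial.eval z))‖ ≤ c)
    (x : PiLp 2 fun _ : Fin n => H) :
    ‖⟪x, matPolyEval T F x⟫_ℂ‖ ≤ 5 / 4 * c * ‖x‖ ^ 2 := by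
  have hcont : Continuous fun r : ℝ => ‖⟪x, matPolyEval (((r ^ 2 : ℝ) : ℂ) • T) F x⟫_ℂ‖ := by
    simp_rw [inner_matPolyEval]
    have hT' : Continuous fun r : ℝ => ((r ^ 2 : ℝ) : ℂ) • T :=
      (Complex.continuous_ofReal.comp (continuous_pow 2)).smul continuous_const
    refine (continuous_finsetSum _ fun i _ => continuous_const.inner
      (continuous_finsetSum _ fun j _ => ?_)).norm
    exact ((F i j).continuous_aeval.comp hT').clm_apply continuous_const
  have hlim := (hcont.tendsto 1).mono_left (nhdsWithin_le_nhds (s := Set.Iio 1))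
  have hle := le_of_tendsto hlim (Filter.eventually_of_mem
    (Ioo_mem_nhdsLT (zero_lt_one' ℝ)) fun r hr =>
      norm_inner_matPolyEval_smul_le hT hr.1.le hr.2 hc hF x)
  simpa using hle

end NumericalRadius
/-- If `w(T) ≤ 1`, then `w(F(T)) ≤ (5/4)·‖F‖_{D̄}` for every matrix polynomial `F`. -/
theorem numRadius_matPolyEval_le_of_numRadius_le_one {H : Type*} [NormedAddCommGroup H]
    [InnerProductSpace ℂ H] [CompleteSpace H] (T : H →L[ℂ] H)
    (hT : numRadius T ≤ 1) :
    ∀ n : ℕ, 1 ≤ n → ∀ F : Matrix (Fin n) (Fin n) (Polynomial ℂ),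
      numRadius (matPolyEval T F) ≤
        (5 / 4) * matPolyNorm (Metric.closedBall (0 : ℂ) 1) F := by
  intro n _ F
  have hF (z : ℂ) (hz : ‖z‖ = 1) :=
    norm_toEuclideanCLM_eval_le_matPolyNorm F (mem_closedBall_zero_iff.2 hz.le)
  have hc := (norm_nonneg _).trans (hF 1 norm_one)
  refine Real.sSup_le ?_ (by positivity)
  rintro _ ⟨x, hx, rfl⟩
  simpa [hx] using
    norm_inner_matPolyEval_le (norm_inner_le_of_numRadius_le_one hT) hc hF x

end
end

section
/- Let T = [[1/2, 3/2], [0, 1/2]] and S = [[2, 0], [0, 1]] be 2×2 complex matrices. Then ‖S⁻¹ T S‖ = 1, ‖S‖·‖S⁻¹‖ = 2, and the numerical radius of T is w(T) = 5/4. -/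
open scoped InnerProductSpace
open ContinuousLinearMap Polynomial

noncomputable section

theorem ContinuousLinearMap.opNorm_eq_of_le_of_attained {E F : Type*} [NormedAddCommGroup E]
    [NormedSpace ℂ E] [NormedAddCommGroup F] [NormedSpace ℂ F] (f : E →L[ℂ] F) {c : ℝ}
    (hc : 0 ≤ c) (hle : ∀ x, ‖f x‖ ≤ c * ‖x‖) {v : E} (hv : v ≠ 0) (hfv : ‖f v‖ = c * ‖v‖) :
    ‖f‖ = c := by
  refine le_antisymm (f.opNorm_le_bound hc hle) ?_
  refine le_of_mul_le_mul_right ?_ (norm_pos_iff.2 hv)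
  exact hfv ▸ f.le_opNorm v

theorem EuclideanSpace.norm_sq_eq_fin_two (x : EuclideanSpace ℂ (Fin 2)) :
    ‖x‖ ^ 2 = ‖x 0‖ ^ 2 + ‖x 1‖ ^ 2 := by
  rw [EuclideanSpace.norm_sq_eq, Fin.sum_univ_two]

theorem Matrix.opNorm_toEuclideanCLM_eq_fin_two (a b d : ℂ) {c : ℝ} (hc : 0 ≤ c)
    (hle : ∀ x y : ℂ, ‖a * x + b * y‖ ^ 2 + ‖d * y‖ ^ 2 ≤ c ^ 2 * (‖x‖ ^ 2 + ‖y‖ ^ 2))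
    (u v : ℂ) (huv : 0 < ‖u‖ ^ 2 + ‖v‖ ^ 2)
    (heq : ‖a * u + b * v‖ ^ 2 + ‖d * v‖ ^ 2 = c ^ 2 * (‖u‖ ^ 2 + ‖v‖ ^ 2)) :
    ‖Matrix.toEuclideanCLM (𝕜 := ℂ) !![a, b; 0, d]‖ = c := by
  have key (x : EuclideanSpace ℂ (Fin 2)) :
      ‖Matrix.toEuclideanCLM (𝕜 := ℂ) !![a, b; 0, d] x‖ ^ 2
        = ‖a * x 0 + b * x 1‖ ^ 2 + ‖d * x 1‖ ^ 2 := by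
    simp [EuclideanSpace.norm_sq_eq_fin_two, Matrix.mulVec, dotProduct, Fin.sum_univ_two]
  refine ContinuousLinearMap.opNorm_eq_of_le_of_attained _ hc (fun x => ?_) (v := !₂[u, v]) ?_ ?_
  · rw [← sq_le_sq₀ (norm_nonneg _) (by positivity), key, mul_pow,
      EuclideanSpace.norm_sq_eq_fin_two]
    exact hle _ _
  · rw [← norm_ne_zero_iff, ← pow_ne_zero_iff two_ne_zero, EuclideanSpace.norm_sq_eq_fin_two]
    exact huv.ne'
  · rw [← sq_eq_sq₀ (norm_nonneg _) (by positivity), key, mul_pow,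
      EuclideanSpace.norm_sq_eq_fin_two]
    exact heq

theorem inner_toEuclideanCLM_fin_two (a b d : ℂ) (x : EuclideanSpace ℂ (Fin 2)) :
    ⟪x, Matrix.toEuclideanCLM (𝕜 := ℂ) !![a, b; 0, d] x⟫_ℂ
      = (a * x 0 + b * x 1) * star (x 0) + d * x 1 * star (x 1) := by
  simp [PiLp.inner_apply, Matrix.mulVec, dotProduct, Fin.sum_univ_two]

theorem numRadius_toEuclideanCLM_eq_five_fourths :
    numRadius (Matrix.toEuclideanCLM (𝕜 := ℂ) !![1/2, 3/2; 0, 1/2]) = 5 / 4 := by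
  refine IsGreatest.csSup_eq ⟨?_, ?_⟩
  · have hs : (√2 / 2 : ℝ) ^ 2 = 1 / 2 := by
      rw [div_pow, Real.sq_sqrt zero_le_two]; norm_num
    refine ⟨!₂[((√2 / 2 : ℝ) : ℂ), ((√2 / 2 : ℝ) : ℂ)], ?_, ?_⟩
    · rw [← sq_eq_sq₀ (norm_nonneg _) zero_le_one, EuclideanSpace.norm_sq_eq_fin_two]
      simp only [Matrix.cons_val_zero, Matrix.cons_val_one, Complex.norm_real,
        Real.norm_eq_abs, sq_abs, hs]
      norm_num
    · rw [inner_toEuclideanCLM_fin_two]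
      simp only [Matrix.cons_val_zero, Matrix.cons_val_one,
        RCLike.star_def, Complex.conj_ofReal]
      have h : (((√2 / 2 : ℝ) : ℂ)) ^ 2 = 1 / 2 := by rw [← Complex.ofReal_pow, hs]; norm_num
      generalize ((√2 / 2 : ℝ) : ℂ) = z at h
      rw [show (1 / 2 * z + 3 / 2 * z) * z + 1 / 2 * z * z = 5 / 4 by linear_combination 5 / 2 * h]
      norm_num
  · rintro r ⟨x, hx, rfl⟩
    have hx' : ‖x 0‖ ^ 2 + ‖x 1‖ ^ 2 = 1 := by
      rw [← EuclideanSpace.norm_sq_eq_fin_two, hx, one_pow]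
    rw [inner_toEuclideanCLM_fin_two]
    calc _ ≤ (‖(1 / 2 : ℂ)‖ * ‖x 0‖ + ‖(3 / 2 : ℂ)‖ * ‖x 1‖) * ‖x 0‖
          + ‖(1 / 2 : ℂ)‖ * ‖x 1‖ * ‖x 1‖ := by
          refine (norm_add_le _ _).trans ?_
          simp only [norm_mul, norm_star]
          gcongr
          refine (norm_add_le _ _).trans ?_
          simp only [norm_mul, le_refl]
      _ ≤ 5 / 4 := by
          norm_num
          nlinarith [sq_nonneg (‖x 0‖ - ‖x 1‖)]

/-- For `T = [[1/2, 3/2], [0, 1/2]]` and `S = [[2, 0], [0, 1]]`: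
`‖S⁻¹ T S‖ = 1`, `‖S‖·‖S⁻¹‖ = 2`, and `w(T) = 5/4`. -/
theorem example_two_spectral_not_numRadius_one (T S : Matrix (Fin 2) (Fin 2) ℂ)
    (hT : T = !![1/2, 3/2; 0, 1/2]) (hS : S = !![2, 0; 0, 1]) :
    ‖Matrix.toEuclideanCLM (𝕜 := ℂ) (S⁻¹ * T * S)‖ = 1 ∧
    ‖Matrix.toEuclideanCLM (𝕜 := ℂ) S‖ * ‖Matrix.toEuclideanCLM (𝕜 := ℂ) S⁻¹‖ = 2 ∧
    numRadius (Matrix.toEuclideanCLM (𝕜 := ℂ) T) = 5 / 4 := by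
  have hSinv : S⁻¹ = !![1/2, 0; 0, 1] := by
    refine Matrix.inv_eq_left_inv ?_
    subst hS
    ext i j
    fin_cases i <;> fin_cases j <;> simp
  have hA : S⁻¹ * T * S = !![1/2, 3/4; 0, 1/2] := by
    rw [hSinv, hT, hS]
    ext i j
    fin_cases i <;> fin_cases j <;> norm_num [Matrix.mul_apply, Fin.sum_univ_two]
  refine ⟨?_, ?_, hT ▸ numRadius_toEuclideanCLM_eq_five_fourths⟩
  · rw [hA]
    refine Matrix.opNorm_toEuclideanCLM_eq_fin_two _ _ _ zero_le_one (fun x y => ?_) 1 2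
      (by norm_num) (by norm_num)
    rw [show (1 / 2 : ℂ) = ((1 / 2 : ℝ) : ℂ) by norm_num,
      show (3 / 4 : ℂ) = ((3 / 4 : ℝ) : ℂ) by norm_num]
    simp only [Complex.sq_norm, Complex.normSq_apply, Complex.add_re, Complex.add_im,
      Complex.re_ofReal_mul, Complex.im_ofReal_mul]
    nlinarith [sq_nonneg (2 * x.re - y.re), sq_nonneg (2 * x.im - y.im)]
  · have hS2 : ‖Matrix.toEuclideanCLM (𝕜 := ℂ) S‖ = 2 := by
      rw [hS]
      refine Matrix.opNorm_toEuclideanCLM_eq_fin_two _ _ _ zero_le_two (fun x y => ?_) 1 0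
        (by norm_num) (by norm_num)
      simp only [zero_mul, add_zero, one_mul, norm_mul, mul_pow, Complex.norm_ofNat]
      nlinarith [sq_nonneg ‖y‖]
    have hS1 : ‖Matrix.toEuclideanCLM (𝕜 := ℂ) S⁻¹‖ = 1 := by
      rw [hSinv]
      refine Matrix.opNorm_toEuclideanCLM_eq_fin_two _ _ _ zero_le_one (fun x y => ?_) 0 1
        (by norm_num) (by norm_num)
      norm_num [mul_pow]
      nlinarith [sq_nonneg ‖x‖]
    rw [hS2, hS1, mul_one]

end
end
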